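/- arXiv:1905.05234 — 4 statements merged into one kernel-verified Lean document; each statement's English description precedes it below -/
import Mathlib

section
/- Suppose G ≤ GL(n, F) is completely reducible, where F is any field. Then the following are equivalent: (i) G is solvable-by-finite; (ii) G is nilpotent-by-finite; (iii) G is abelian-by-finite. -/
open Matrix

/-- A subspace of `F^n` is invariant under the subgroup `G` of `GL(n,F)`. -/
def InvariantUnder {n : ℕ} {F : Type*} [Field F] (G : Subgroup (GL (Fin n) F))
    (W : Submodule F (Fin n → F)) : Prop :=
  ∀ g ∈ G, ∀ v ∈ W, (g : Matrix (Fin n) (Fin n) F) *ᵥ v ∈ W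

/-- `G ≤ GL(n,F)` is completely reducible if every `G`-invariant subspace of `F^n` has a
`G`-invariant complement. -/
def CompletelyReducible {n : ℕ} {F : Type*} [Field F] (G : Subgroup (GL (Fin n) F)) : Prop :=
  ∀ W : Submodule F (Fin n → F), InvariantUnder G W →
    ∃ W' : Submodule F (Fin n → F), InvariantUnder G W' ∧ IsCompl W W'

open Polynomial in
/-- In a reduced Noetherian algebra over a field, a nonzero polynomial has finitely many roots. -/
lemma finite_setOf_aeval_eq_zero {F R : Type*} [Field F] [CommRing R] [Algebra F R] [IsReduced R]
    [IsNoetherianRing R] {p : F[X]} (hp : p ≠ 0) : {x : R | aeval x p = 0}.Finite := by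
  have : Finite (minimalPrimes R) := minimalPrimes.finite_of_isNoetherianRing R
  let f : R → (P : minimalPrimes R) → R ⧸ P.1 := fun x P => Ideal.Quotient.mk P.1 x
  have hf : Function.Injective f := by
    intro x y hxy
    have h : x - y ∈ sInf (minimalPrimes R) := by
      rw [Submodule.mem_sInf]
      intro P hP
      exact Ideal.Quotient.eq.1 (congrFun hxy ⟨P, hP⟩)
    have h' : x - y ∈ nilradical R := by
      rw [nilradical, ← Ideal.sInf_minimalPrimes]
      exact h
    rw [nilradical_eq_zero, Ideal.zero_eq_bot, Ideal.mem_bot] at h'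
    exact sub_eq_zero.1 h'
  refine Set.Finite.of_finite_image (f := f) ?_ hf.injOn
  refine (Set.Finite.pi' (t := fun P : minimalPrimes R => {x : R ⧸ P.1 | aeval x p = 0})
    fun P => ?_).subset ?_
  · have : P.1.IsPrime := P.2.1.1
    have h0 : p.map (algebraMap F (R ⧸ P.1)) ≠ 0 :=
      (Polynomial.map_ne_zero_iff (algebraMap F (R ⧸ P.1)).injective).2 hp
    refine (finite_setOfPred_isRoot h0).subset fun x hx => ?_
    simpa [IsRoot, aeval_def, eval_map] using hx
  · rintro _ ⟨x, hx, rfl⟩ P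
    have := congrArg (Ideal.Quotient.mkₐ F P.1) (show aeval x p = 0 from hx)
    rw [← aeval_algHom_apply, map_zero] at this
    exact this

open Polynomial in
open scoped IsMulCommutative in
lemma finite_setOf_mem_adjoin_aeval_eq_zero {F E : Type*} [Field F] [Ring E] [Algebra F E]
    [FiniteDimensional F E] {s : Set E} (hs : ∀ a ∈ s, ∀ b ∈ s, a * b = b * a)
    (hred : ∀ x ∈ Algebra.adjoin F s, IsNilpotent x → x = 0) {p : F[X]} (hp : p ≠ 0) :
    {x : E | x ∈ Algebra.adjoin F s ∧ aeval x p = 0}.Finite := by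
  have := Algebra.isMulCommutative_adjoin F hs
  have : IsNoetherianRing (Algebra.adjoin F s) := isNoetherian_of_tower F inferInstance
  have : IsReduced (Algebra.adjoin F s) :=
    ⟨fun x hx => Subtype.ext (hred x x.2 (hx.map (Algebra.adjoin F s).val))⟩
  refine ((finite_setOf_aeval_eq_zero (R := Algebra.adjoin F s) hp).image Subtype.val).subset ?_
  rintro x ⟨hx, hpx⟩
  refine ⟨⟨x, hx⟩, ?_, rfl⟩
  apply Subtype.ext
  have := (aeval_algHom_apply (Algebra.adjoin F s).val ⟨x, hx⟩ p)
  exact this.symm.trans hpx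

lemma Subgroup.finiteIndex_of_finite_range {G α : Type*} [Group G] (K : Subgroup G) (f : G → α)
    (hf : (Set.range f).Finite) (h : ∀ g k, f g = f k → g⁻¹ * k ∈ K) : K.FiniteIndex := by
  have := hf.to_subtype
  have : Finite (G ⧸ K) := by
    refine Finite.of_injective (fun q : G ⧸ K => (⟨f q.out, q.out, rfl⟩ : Set.range f)) ?_
    intro q r hqr
    have := QuotientGroup.eq.2 (h _ _ (Subtype.ext_iff.1 hqr))
    simpa using this
  exact Subgroup.finiteIndex_of_finite_quotient

lemma Subgroup.finiteIndex_centralizer_of_finite {G : Type*} [Group G] (x : G)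
    (hx : (Set.range fun g : G => g⁻¹ * x * g).Finite) :
    (Subgroup.centralizer {x}).FiniteIndex := by
  refine Subgroup.finiteIndex_of_finite_range _ (fun g : G => g * x * g⁻¹) ?_ ?_
  · refine hx.subset ?_
    rintro _ ⟨g, rfl⟩
    exact ⟨g⁻¹, by simp⟩
  · intro g k h
    rw [Subgroup.mem_centralizer_singleton_iff]
    have h' : g * x * g⁻¹ = k * x * k⁻¹ := h
    have : x = g⁻¹ * (k * x * k⁻¹) * g := by rw [← h']; group
    calc _ = g⁻¹ * (k * x * k⁻¹) * g * (g⁻¹ * k) := by group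
      _ = x * (g⁻¹ * k) := by rw [← this]

section Representation

open scoped commutatorElement

variable {F E G : Type*} [Field F] [Ring E] [Algebra F E] [Group G]

/-- Every abelian normal subgroup spans a reduced subalgebra. -/
def ReducedOnAbelianNormal (F : Type*) {E G : Type*} [Field F] [Ring E] [Algebra F E] [Group G]
    (ρ : G →* E) : Prop :=
  ∀ S : Subgroup G, S.Normal → (∀ a ∈ S, ∀ b ∈ S, a * b = b * a) →
    ∀ x ∈ Algebra.adjoin F (ρ '' S), IsNilpotent x → x = 0

lemma ReducedOnAbelianNormal.finite_roots [FiniteDimensional F E] {ρ : G →* E}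
    (hρ : Function.Injective ρ) (hred : ReducedOnAbelianNormal F ρ) {S : Subgroup G} (hS : S.Normal)
    (hcomm : ∀ a ∈ S, ∀ b ∈ S, a * b = b * a) {p : Polynomial F} (hp : p ≠ 0) :
    {s : G | s ∈ S ∧ Polynomial.aeval (ρ s) p = 0}.Finite := by
  refine Set.Finite.of_finite_image (f := ρ) ?_ hρ.injOn
  refine (finite_setOf_mem_adjoin_aeval_eq_zero (s := ρ '' S) ?_ (hred S hS hcomm) hp).subset ?_
  · rintro _ ⟨a, ha, rfl⟩ _ ⟨b, hb, rfl⟩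
    rw [← map_mul, hcomm a ha b hb, map_mul]
  · rintro _ ⟨s, ⟨hs, hps⟩, rfl⟩
    exact ⟨Algebra.subset_adjoin ⟨s, hs, rfl⟩, hps⟩

lemma finiteIndex_centralizer_of_mem_abelian_normal [FiniteDimensional F E] {ρ : G →* E}
    (hρ : Function.Injective ρ) (hred : ReducedOnAbelianNormal F ρ) {S : Subgroup G} (hS : S.Normal)
    (hcomm : ∀ a ∈ S, ∀ b ∈ S, a * b = b * a) {s : G} (hs : s ∈ S) :
    (Subgroup.centralizer {s}).FiniteIndex := by
  apply Subgroup.finiteIndex_centralizer_of_finite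
  have hint : IsIntegral F (ρ s) := IsIntegral.of_finite F _
  refine (hred.finite_roots hρ hS hcomm (minpoly.ne_zero hint)).subset ?_
  rintro _ ⟨g, rfl⟩
  refine ⟨by simpa using hS.conj_mem s hs g⁻¹, ?_⟩
  have key : ∀ p : Polynomial F, Polynomial.aeval (ρ (g⁻¹ * s * g)) p =
      ρ g⁻¹ * Polynomial.aeval (ρ s) p * ρ g := by
    intro p
    have hg : ρ g⁻¹ * ρ g = 1 := by rw [← map_mul]; simp
    induction p using Polynomial.induction_on' with
    | add p q hp hq => simp only [map_add, hp, hq, mul_add, add_mul]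
    | monomial k c =>
      have hpow : (g⁻¹ * s * g) ^ k = g⁻¹ * s ^ k * g := by
        simpa using conj_pow (i := k) (a := g⁻¹) (b := s)
      rw [Polynomial.aeval_monomial, Polynomial.aeval_monomial, ← map_pow, ← map_pow, hpow,
        map_mul, map_mul, ← mul_assoc (ρ g⁻¹), ← Algebra.commutes c (ρ g⁻¹)]
      simp only [mul_assoc]
  rw [key, minpoly.aeval, mul_zero, zero_mul]

/-- The commutators of a fixed `a` which lie in an abelian normal subgroup centralized by `a`
form a finite set. -/
lemma finite_commutators_mem [FiniteDimensional F E] {ρ : G →* E}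
    (hρ : Function.Injective ρ) (hred : ReducedOnAbelianNormal F ρ) {Z : Subgroup G} (hZ : Z.Normal)
    (hcomm : ∀ a ∈ Z, ∀ b ∈ Z, a * b = b * a) {a : G} (ha : ∀ z ∈ Z, a * z = z * a) :
    {z : G | z ∈ Z ∧ ∃ h : G, ⁅a, h⁆ = z}.Finite := by
  let T : Module.End F E := LinearMap.mulLeft F (ρ a) ∘ₗ LinearMap.mulRight F (ρ a⁻¹)
  have hT : ∀ x, T x = ρ a * (x * ρ a⁻¹) := fun x => rfl
  have hint : IsIntegral F T := IsIntegral.of_finite F T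
  refine (hred.finite_roots hρ hZ hcomm (minpoly.ne_zero hint)).subset ?_
  rintro z ⟨hz, h, hh⟩
  refine ⟨hz, ?_⟩
  have hTh : T (ρ h) = ρ z * ρ h := by
    rw [hT, ← map_mul, ← map_mul, ← map_mul, ← hh, commutatorElement_def]
    congr 1; group
  have hTz : ∀ x, T (ρ z * x) = ρ z * T x := by
    intro x
    rw [hT, hT, ← mul_assoc, ← mul_assoc, ← map_mul, ha z hz, map_mul]
    simp only [mul_assoc]
  have hpow : ∀ k : ℕ, (T ^ k) (ρ h) = ρ z ^ k * ρ h := by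
    intro k
    induction k with
    | zero => simp
    | succ k ih =>
      have aux : ∀ (j : ℕ) x, T (ρ z ^ j * x) = ρ z ^ j * T x := by
        intro j
        induction j with
        | zero => simp
        | succ j ihj => intro x; rw [pow_succ, mul_assoc, ihj, hTz, mul_assoc]
      rw [pow_succ', Module.End.mul_apply, ih, aux, hTh, pow_succ, mul_assoc]
  have key : ∀ p : Polynomial F, Polynomial.aeval T p (ρ h) =
      Polynomial.aeval (ρ z) p * ρ h := by
    intro p
    induction p using Polynomial.induction_on' with
    | add p q hp hq => simp only [map_add, LinearMap.add_apply, hp, hq, add_mul]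
    | monomial k c =>
      simp [Polynomial.aeval_monomial, hpow, Module.algebraMap_end_apply, Algebra.smul_def,
        mul_assoc]
  have h0 := key (minpoly F T)
  rw [minpoly.aeval, LinearMap.zero_apply] at h0
  calc _ = Polynomial.aeval (ρ z) (minpoly F T) * ρ h * ρ h⁻¹ := by
        rw [mul_assoc, ← map_mul]; simp
    _ = 0 := by rw [← h0, zero_mul]

lemma commute_of_mem_span {ρ : G →* E} (hρ : Function.Injective ρ) {s : Set G} {x y : G}
    (hx : ∀ t ∈ s, x * t = t * x) (hy : ρ y ∈ Submodule.span F (ρ '' s)) : x * y = y * x := by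
  apply hρ
  rw [map_mul, map_mul]
  generalize ρ y = e at hy
  induction hy using Submodule.span_induction with
  | mem z hz => obtain ⟨t, ht, rfl⟩ := hz; rw [← map_mul, hx t ht, map_mul]
  | zero => simp
  | add a b _ _ ha hb => rw [mul_add, add_mul, ha, hb]
  | smul c a _ ha => rw [mul_smul_comm, smul_mul_assoc, ha]

/-- Below a normal subgroup of finite index there is another one, `H`, such that any element with
centralizer of finite index centralizes `H`. -/
lemma exists_normal_finiteIndex_centralizing [FiniteDimensional F E] {ρ : G →* E}
    (hρ : Function.Injective ρ) (N : Subgroup G) (hN : N.Normal) (hfin : N.FiniteIndex) :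
    ∃ H ≤ N, H.Normal ∧ H.FiniteIndex ∧
      ∀ x : G, (Subgroup.centralizer {x}).FiniteIndex → ∀ h ∈ H, x * h = h * x := by
  let d : Subgroup G → ℕ := fun H => Module.finrank F (Submodule.span F (ρ '' (H : Set G)))
  obtain ⟨H, ⟨hHN, hHn, hHf⟩, hmin⟩ := exists_minimalFor_of_wellFoundedLT
    (fun H : Subgroup G => H ≤ N ∧ H.Normal ∧ H.FiniteIndex) d ⟨N, le_rfl, hN, hfin⟩
  refine ⟨H, hHN, hHn, hHf, fun x hx h hh => ?_⟩
  let K := (Subgroup.centralizer {x} ⊓ H).normalCore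
  have hKle : K ≤ Subgroup.centralizer {x} ⊓ H := Subgroup.normalCore_le _
  have hspan : Submodule.span F (ρ '' (K : Set G)) ≤ Submodule.span F (ρ '' (H : Set G)) :=
    Submodule.span_mono (Set.image_mono fun _ hk => (hKle hk).2)
  have hle : d K ≤ d H := Submodule.finrank_mono hspan
  have hge : d H ≤ d K :=
    hmin ⟨hKle.trans (inf_le_right.trans hHN), inferInstance, inferInstance⟩ hle
  have heq := Submodule.eq_of_le_of_finrank_le hspan hge
  refine commute_of_mem_span (F := F) hρ (s := K) (fun t ht => ?_) ?_
  · exact (Subgroup.mem_centralizer_singleton_iff.1 (hKle ht).1).symm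
  · rw [heq]
    exact Submodule.subset_span ⟨h, hh, rfl⟩

lemma le_centralizer_of_commutator_le [FiniteDimensional F E] {ρ : G →* E}
    (hρ : Function.Injective ρ) (hred : ReducedOnAbelianNormal F ρ) {H : Subgroup G}
    (hHn : H.Normal)
    (hH : ∀ x : G, (Subgroup.centralizer {x}).FiniteIndex → ∀ h ∈ H, x * h = h * x)
    {A : Subgroup G} (hA : A.Normal) (hAH : A ≤ H)
    (hcomm : ⁅A, A⁆ ≤ H ⊓ Subgroup.centralizer H) : A ≤ H ⊓ Subgroup.centralizer H := by
  set Z : Subgroup G := H ⊓ Subgroup.centralizer H with hZdef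
  have hZn : Z.Normal := inferInstance
  have hZc : ∀ a ∈ H, ∀ z ∈ Z, a * z = z * a := fun a ha z hz => hz.2 a ha
  have hZZ : ∀ a ∈ Z, ∀ b ∈ Z, a * b = b * a := fun a ha b hb => hZc a ha.1 b hb
  have hcf : ∀ a ∈ A, {z : G | z ∈ Z ∧ ∃ h : G, ⁅a, h⁆ = z}.Finite := fun a ha =>
    finite_commutators_mem hρ hred hZn hZZ (hZc a (hAH ha))
  -- `A` is finite modulo `Z`
  have hfin : (Z.subgroupOf A).FiniteIndex := by
    obtain ⟨t, ht, hspan⟩ := (Submodule.fg_span_iff_fg_span_finset_subset (R := F)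
      (ρ '' (A : Set G))).1 (IsNoetherian.noetherian _)
    let C : Subgroup G := A ⊓ Subgroup.centralizer A
    have hCZ : C ≤ Z := by
      intro c hc
      refine ⟨hAH hc.1, fun h hh => ?_⟩
      refine (hH c ?_ h hh).symm
      have hCn : C.Normal := inferInstance
      exact finiteIndex_centralizer_of_mem_abelian_normal hρ hred hCn
        (fun a ha b hb => hb.2 a ha.1) hc
    let T : Set G := {x | x ∈ A ∧ ρ x ∈ t}
    have hT : T.Finite := by
      refine Set.Finite.of_finite_image (f := ρ) (t.finite_toSet.subset ?_) hρ.injOn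
      rintro _ ⟨x, hx, rfl⟩
      exact hx.2
    have := hT.to_subtype
    refine Subgroup.finiteIndex_of_finite_range _ (fun (h : A) (x : T) => ⁅(x : G), (h : G)⁆)
      ((Set.Finite.pi' fun x : T => hcf x x.2.1).subset ?_) ?_
    · rintro _ ⟨h, rfl⟩ x
      exact ⟨hcomm (Subgroup.commutator_mem_commutator x.2.1 h.2), h, rfl⟩
    · intro g k hgk
      refine hCZ ⟨(g⁻¹ * k).2, fun y hy => ?_⟩
      refine (commute_of_mem_span (F := F) hρ (s := T) (x := ((g⁻¹ * k : A) : G)) ?_ ?_).symm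
      · intro x hx
        have h1 : ⁅x, (g : G)⁆ = ⁅x, (k : G)⁆ := congrFun hgk ⟨x, hx⟩
        simp only [commutatorElement_def, mul_assoc, mul_right_inj] at h1
        have h2 : (g : G) * (x⁻¹ * (g : G)⁻¹) = k * (x⁻¹ * (k : G)⁻¹) := by simpa using h1
        have h3 : (g : G)⁻¹ * (k * (x⁻¹ * (k : G)⁻¹)) * g = x⁻¹ := by rw [← h2]; group
        have h4 : x = (g : G)⁻¹ * (k * (x * (k : G)⁻¹)) * g := by
          have h5 := congrArg (·⁻¹) h3
          simp only [inv_inv] at h5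
          refine h5.symm.trans ?_
          group
        push_cast
        calc (g : G)⁻¹ * k * x = (g : G)⁻¹ * (k * (x * (k : G)⁻¹)) * g * ((g : G)⁻¹ * k) := by
              group
          _ = x * ((g : G)⁻¹ * k) := by rw [← h4]
      · have hy' : ρ y ∈ Submodule.span F (ρ '' (A : Set G)) :=
          Submodule.subset_span ⟨y, hy, rfl⟩
        rw [hspan] at hy'
        refine Submodule.span_mono ?_ hy'
        intro e he
        obtain ⟨x, hx, rfl⟩ := ht he
        exact ⟨x, ⟨hx, he⟩, rfl⟩
  intro a ha
  refine ⟨hAH ha, fun h hh => (hH a ?_ h hh).symm⟩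
  apply Subgroup.finiteIndex_centralizer_of_finite
  have hmem : ∀ g : G, g⁻¹ * a * g ∈ A := fun g => by simpa using hA.conj_mem a ha g⁻¹
  let q : G → A ⧸ Z.subgroupOf A := fun g => QuotientGroup.mk ⟨g⁻¹ * a * g, hmem g⟩
  have hcover : (Set.range fun g : G => g⁻¹ * a * g) ⊆
      ⋃ c : A ⧸ Z.subgroupOf A, (fun g : G => g⁻¹ * a * g) '' {g | q g = c} := by
    rintro _ ⟨g, rfl⟩
    exact Set.mem_iUnion.2 ⟨q g, g, rfl, rfl⟩
  refine (Set.finite_iUnion fun c => ?_).subset hcover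
  by_cases hc : ∃ g₀, q g₀ = c
  · obtain ⟨g₀, rfl⟩ := hc
    refine ((hcf a⁻¹ (A.inv_mem ha)).image fun z => g₀⁻¹ * (a * z) * g₀).subset ?_
    rintro _ ⟨g, hg, rfl⟩
    have hz : (g₀⁻¹ * a * g₀)⁻¹ * (g⁻¹ * a * g) ∈ Z := by
      have := QuotientGroup.eq.1 (show q g₀ = q g from hg.symm)
      exact this
    refine ⟨⁅a⁻¹, g₀ * g⁻¹⁆, ⟨?_, _, rfl⟩, ?_⟩
    · have := hZn.conj_mem _ hz g₀
      convert this using 1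
      rw [commutatorElement_def]; group
    · simp only [commutatorElement_def]; group
  · convert Set.finite_empty
    ext y
    simp only [Set.mem_image, Set.mem_ofPred_eq, Set.mem_empty_iff_false, iff_false]
    rintro ⟨g, hg, -⟩
    exact hc ⟨g, hg⟩

lemma exists_abelian_normal_finiteIndex [FiniteDimensional F E] {ρ : G →* E}
    (hρ : Function.Injective ρ) (hred : ReducedOnAbelianNormal F ρ) (N : Subgroup G)
    (hN : N.Normal) (hfin : N.FiniteIndex) (hsol : Group.IsSolvable N) :
    ∃ H : Subgroup G, H.Normal ∧ H.FiniteIndex ∧ ∀ a b : H, a * b = b * a := by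
  obtain ⟨H, hHN, hHn, hHf, hH⟩ := exists_normal_finiteIndex_centralizing (F := F) hρ N hN hfin
  refine ⟨H, hHn, hHf, ?_⟩
  have hHsol : Group.IsSolvable H :=
    Group.isSolvable_of_isSolvable_injective (Subgroup.inclusion_injective hHN)
  obtain ⟨n, hn⟩ := hHsol.solvable
  have main : ∀ j ≤ n, (derivedSeries H j).map H.subtype ≤ H ⊓ Subgroup.centralizer H := by
    intro j hj
    induction hj using Nat.decreasingInduction with
    | self => rw [hn, Subgroup.map_bot]; exact bot_le
    | of_succ k _ ih =>
      refine le_centralizer_of_commutator_le hρ hred hHn hH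
        (ConjAct.normal_of_characteristic_of_normal) (Subgroup.map_subtype_le _) ?_
      rw [← Subgroup.map_commutator, ← derivedSeries_succ]
      exact ih
  have h0 := main 0 (Nat.zero_le n)
  intro a b
  have ha := (h0 ⟨a, by simp, rfl⟩).2
  exact Subtype.ext (ha b b.2).symm

end Representation

/-- The action of a subgroup of `GL(n,F)` by matrices. -/
def Subgroup.toMatrixHom {n : ℕ} {F : Type*} [Field F] (G : Subgroup (GL (Fin n) F)) :
    G →* Matrix (Fin n) (Fin n) F :=
  (Units.coeHom _).comp G.subtype

open scoped IsMulCommutative in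
lemma CompletelyReducible.reducedOnAbelianNormal {n : ℕ} {F : Type*} [Field F]
    {G : Subgroup (GL (Fin n) F)} (hcr : CompletelyReducible G) :
    ReducedOnAbelianNormal F G.toMatrixHom := by
  intro S hS hcomm
  set ρ := G.toMatrixHom with hρ
  set R := Algebra.adjoin F (ρ '' (S : Set G)) with hR
  have hs : ∀ a ∈ ρ '' (S : Set G), ∀ b ∈ ρ '' (S : Set G), a * b = b * a := by
    rintro _ ⟨a, ha, rfl⟩ _ ⟨b, hb, rfl⟩
    rw [← map_mul, hcomm a ha b hb, map_mul]
  let W : Submodule F (Fin n → F) :=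
    { carrier := {v | ∀ y ∈ R, IsNilpotent y → y *ᵥ v = 0}
      add_mem' := fun {u v} hu hv y hy hn => by
        rw [Matrix.mulVec_add, hu y hy hn, hv y hy hn, add_zero]
      zero_mem' := fun y _ _ => Matrix.mulVec_zero y
      smul_mem' := fun c v hv y hy hn => by
        rw [Matrix.mulVec_smul, hv y hy hn, smul_zero] }
  have hconj : ∀ g : G, ∀ y ∈ R, ρ g⁻¹ * y * ρ g ∈ R := by
    intro g y hy
    have hg : ρ g * ρ g⁻¹ = 1 := by rw [← map_mul]; simp
    have hg' : ρ g⁻¹ * ρ g = 1 := by rw [← map_mul]; simp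
    induction hy using Algebra.adjoin_induction with
    | mem y hy =>
      obtain ⟨s, hs, rfl⟩ := hy
      rw [← map_mul, ← map_mul]
      exact Algebra.subset_adjoin ⟨_, by simpa using hS.conj_mem s hs g⁻¹, rfl⟩
    | algebraMap r =>
      rw [← Algebra.commutes r (ρ g⁻¹), mul_assoc, hg', mul_one]
      exact R.algebraMap_mem r
    | add a b _ _ ha hb => rw [mul_add, add_mul]; exact R.add_mem ha hb
    | mul a b _ _ ha hb =>
      have : ρ g⁻¹ * (a * b) * ρ g = (ρ g⁻¹ * a * ρ g) * (ρ g⁻¹ * b * ρ g) := by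
        calc _ = ρ g⁻¹ * a * 1 * b * ρ g := by simp only [mul_assoc, mul_one]
          _ = _ := by rw [← hg]; simp only [mul_assoc]
      rw [this]
      exact R.mul_mem ha hb
  have hW : InvariantUnder G W := by
    intro g hg v hv y hy hn
    let g' : G := ⟨g, hg⟩
    have h1 : ρ g' * ρ g'⁻¹ = 1 := by rw [← map_mul]; simp
    have hnil : IsNilpotent (ρ g'⁻¹ * y * ρ g') := by
      obtain ⟨k, hk⟩ := hn
      refine ⟨k, ?_⟩
      have : ∀ j : ℕ, (ρ g'⁻¹ * y * ρ g') ^ j = ρ g'⁻¹ * y ^ j * ρ g' := by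
        intro j
        induction j with
        | zero => rw [pow_zero, pow_zero, mul_one, ← map_mul]; simp
        | succ j ih =>
          rw [pow_succ, ih, pow_succ]
          calc _ = ρ g'⁻¹ * y ^ j * (ρ g' * ρ g'⁻¹) * y * ρ g' := by simp only [mul_assoc]
            _ = _ := by rw [h1]; simp only [mul_assoc, one_mul]
      rw [this, hk, mul_zero, zero_mul]
    have h2 := hv _ (hconj g' y hy) hnil
    change y *ᵥ (ρ g' *ᵥ v) = 0
    calc y *ᵥ (ρ g' *ᵥ v) = (ρ g' * (ρ g'⁻¹ * y * ρ g')) *ᵥ v := by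
          rw [Matrix.mulVec_mulVec, ← mul_assoc, ← mul_assoc, h1, one_mul]
      _ = 0 := by rw [← Matrix.mulVec_mulVec, h2, Matrix.mulVec_zero]
  obtain ⟨W', hW', hcompl⟩ := hcr W hW
  have hRW' : ∀ y ∈ R, ∀ v ∈ W', y *ᵥ v ∈ W' := by
    intro y hy
    induction hy using Algebra.adjoin_induction with
    | mem y hy => obtain ⟨s, hs, rfl⟩ := hy; exact hW' s s.2
    | algebraMap r =>
      intro v hv
      rw [Algebra.algebraMap_eq_smul_one, Matrix.smul_mulVec, Matrix.one_mulVec]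
      exact W'.smul_mem r hv
    | add a b _ _ ha hb =>
      intro v hv; rw [Matrix.add_mulVec]; exact W'.add_mem (ha v hv) (hb v hv)
    | mul a b _ _ ha hb =>
      intro v hv; rw [← Matrix.mulVec_mulVec]; exact ha _ (hb v hv)
  have := Algebra.isMulCommutative_adjoin F hs
  have hnoeth : IsNoetherianRing R := isNoetherian_of_tower F inferInstance
  obtain ⟨m, hm⟩ := IsNoetherianRing.isNilpotent_nilradical R
  have hbot : W' = ⊥ := by
    have step : ∀ k ≤ m, ∀ u ∈ (nilradical R) ^ k, ∀ v ∈ W',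
        (u : Matrix (Fin n) (Fin n) F) *ᵥ v = 0 := by
      intro k hk
      induction hk using Nat.decreasingInduction with
      | self =>
        intro u hu v _
        rw [hm] at hu
        have : u = 0 := hu
        rw [this]
        exact Matrix.zero_mulVec v
      | of_succ k _ ih =>
        intro u hu v hv
        refine (Submodule.disjoint_def.1 hcompl.disjoint) _ ?_ (hRW' u u.2 v hv)
        intro y hy hn
        rw [Matrix.mulVec_mulVec]
        have hyn : (⟨y, hy⟩ : R) ∈ nilradical R := by
          obtain ⟨j, hj⟩ := hn
          exact ⟨j, Subtype.ext hj⟩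
        refine ih (⟨y, hy⟩ * u) ?_ v hv
        rw [pow_succ']
        exact Ideal.mul_mem_mul hyn hu
    rw [eq_bot_iff]
    intro v hv
    have := step 0 (Nat.zero_le m) 1 (by simp) v hv
    have h1 : ((1 : R) : Matrix (Fin n) (Fin n) F) = 1 := rfl
    rwa [h1, Matrix.one_mulVec] at this
  have htop : W = ⊤ := by
    have := hcompl.sup_eq_top
    rwa [hbot, sup_bot_eq] at this
  intro x hx hn
  apply Matrix.toLin'.injective
  ext1 i
  refine LinearMap.ext fun c => ?_
  have hv : (Pi.single i c : Fin n → F) ∈ W := htop ▸ Submodule.mem_top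
  simpa using hv x hx hn

/-- For a completely reducible `G ≤ GL(n,F)`: solvable-by-finite, nilpotent-by-finite and
abelian-by-finite are equivalent. -/
theorem stmt4 {n : ℕ} {F : Type*} [Field F] (G : Subgroup (GL (Fin n) F))
    (hcr : CompletelyReducible G) :
    ((∃ N : Subgroup G, N.Normal ∧ N.FiniteIndex ∧ IsSolvable N) ↔
      (∃ N : Subgroup G, N.Normal ∧ N.FiniteIndex ∧ Group.IsNilpotent N)) ∧
    ((∃ N : Subgroup G, N.Normal ∧ N.FiniteIndex ∧ Group.IsNilpotent N) ↔
      (∃ N : Subgroup G, N.Normal ∧ N.FiniteIndex ∧ ∀ a b : N, a * b = b * a)) := by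
  have hab : (∃ N : Subgroup G, N.Normal ∧ N.FiniteIndex ∧ Group.IsSolvable N) →
      ∃ N : Subgroup G, N.Normal ∧ N.FiniteIndex ∧ ∀ a b : N, a * b = b * a := by
    rintro ⟨N, hN, hfin, hsol⟩
    exact exists_abelian_normal_finiteIndex (F := F) (ρ := G.toMatrixHom)
      (Units.val_injective.comp Subtype.val_injective) hcr.reducedOnAbelianNormal N hN hfin hsol
  have hnil : (∃ N : Subgroup G, N.Normal ∧ N.FiniteIndex ∧ ∀ a b : N, a * b = b * a) →
      ∃ N : Subgroup G, N.Normal ∧ N.FiniteIndex ∧ Group.IsNilpotent N := by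
    rintro ⟨N, hN, hfin, hcomm⟩
    let : CommGroup N := { (inferInstance : Group N) with mul_comm := hcomm }
    exact ⟨N, hN, hfin, CommGroup.isNilpotent⟩
  have hsol : (∃ N : Subgroup G, N.Normal ∧ N.FiniteIndex ∧ Group.IsNilpotent N) →
      ∃ N : Subgroup G, N.Normal ∧ N.FiniteIndex ∧ Group.IsSolvable N := by
    rintro ⟨N, hN, hfin, hn⟩
    exact ⟨N, hN, hfin, IsNilpotent.to_isSolvable⟩
  exact ⟨⟨hnil ∘ hab, hsol⟩, ⟨hab ∘ hsol, hnil⟩⟩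
end

section
/- Let G ≤ GL(n, F) and let H = ⟨K^G⟩ be the normal closure in G of a finite subset K ⊆ G. Write each h ∈ GL(n, F) via its multiplicative Jordan decomposition h = h_d h_u, and set K_d = {h_d : h ∈ K, g ∈ G conjugates}^G appropriately, precisely K_d^G = {(h^g)_d : h ∈ K, g ∈ G} and K_u^G = {(h^g)_u : h ∈ K, g ∈ G}. Then H is nilpotent with H' unipotent if and only if ⟨K_d^G⟩ is abelian, ⟨K_u^G⟩ is unipotent, and every element of K_d^G commutes with every element of K_u^G. -/
open Matrix

/-- A matrix over `F` is diagonalizable (semisimple) if it is conjugate to a diagonal matrix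
over the algebraic closure of `F`. -/
def IsDiagonalizableMat {n : ℕ} {F : Type*} [Field F] (m : Matrix (Fin n) (Fin n) F) : Prop :=
  ∃ P : GL (Fin n) (AlgebraicClosure F),
    (((P⁻¹ : GL (Fin n) (AlgebraicClosure F)) : Matrix (Fin n) (Fin n) (AlgebraicClosure F)) *
        m.map (algebraMap F (AlgebraicClosure F)) *
        (P : Matrix (Fin n) (Fin n) (AlgebraicClosure F))).IsDiag

/-- A matrix all of whose multiples by polynomials in itself have trace zero is nilpotent. -/
theorem isNilpotent_of_forall_trace_mul_aeval_eq_zero {ι F : Type*} [Fintype ι] [DecidableEq ι]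
    [Field F] [CharZero F] (a : Matrix ι ι F)
    (h : ∀ p : Polynomial F, (a * Polynomial.aeval a p).trace = 0) : IsNilpotent a := by
  obtain ⟨q, hq, hX⟩ := Polynomial.exists_eq_pow_rootMultiplicity_mul_and_not_dvd a.charpoly
    a.charpoly_monic.ne_zero 0
  set k := a.charpoly.rootMultiplicity 0
  rw [Polynomial.C_0, sub_zero] at hq hX
  have hcop : IsCoprime (Polynomial.X ^ (k + 1) : Polynomial F) q :=
    ((Polynomial.irreducible_X.coprime_iff_not_dvd).2 hX).pow_left
  obtain ⟨r, s, hrs⟩ := hcop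
  have hann : Polynomial.aeval a (Polynomial.X ^ (k + 1) * q) = 0 := by
    rw [pow_succ', mul_assoc, ← hq, map_mul, Matrix.aeval_self_charpoly, mul_zero]
  have hidem : IsIdempotentElem (Polynomial.aeval a (r * Polynomial.X ^ (k + 1))) := by
    have : (r * Polynomial.X ^ (k + 1)) * (r * Polynomial.X ^ (k + 1)) =
        r * Polynomial.X ^ (k + 1) - r * s * (Polynomial.X ^ (k + 1) * q) := by
      linear_combination (r * Polynomial.X ^ (k + 1)) * hrs
    rw [IsIdempotentElem, ← map_mul, this, map_sub, map_mul _ (r * s), hann, mul_zero, sub_zero]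
  have htr : (Polynomial.aeval a (r * Polynomial.X ^ (k + 1))).trace = 0 := by
    rw [show r * Polynomial.X ^ (k + 1) = Polynomial.X * (r * Polynomial.X ^ k) by ring,
      map_mul, Polynomial.aeval_X]
    exact h _
  have hzero : Polynomial.aeval a (r * Polynomial.X ^ (k + 1)) = 0 := by
    have hl := hidem.map (Matrix.toLinAlgEquiv' : Matrix ι ι F ≃ₐ[F] _)
    have := LinearMap.IsIdempotentElem.eq_zero_of_trace_eq_zero hl
      ((Matrix.trace_toLin'_eq _).trans htr)
    exact (map_eq_zero_iff _ (AlgEquiv.injective _)).1 this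
  refine ⟨k + 1, ?_⟩
  have : (Polynomial.X ^ (k + 1) : Polynomial F) =
      Polynomial.X ^ (k + 1) * (r * Polynomial.X ^ (k + 1)) + s * (Polynomial.X ^ (k + 1) * q) := by
    linear_combination (-Polynomial.X ^ (k + 1)) * hrs
  have h2 := congrArg (Polynomial.aeval a) this
  rw [map_add, map_mul, hzero, map_mul _ s, hann] at h2
  simpa using h2

section UnipotentGroups

variable {n : ℕ} {F : Type*} [Field F]

/-- The descending chain of subspaces obtained from the whole space by repeatedly applying the
operators `u - 1` for `u` in `U`. -/
def unipotentFiltration (U : Subgroup (GL (Fin n) F)) : ℕ → Submodule F (Fin n → F)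
  | 0 => ⊤
  | i + 1 => Submodule.span F
      {w | ∃ u ∈ U, ∃ v ∈ unipotentFiltration U i, w = ((u : Matrix (Fin n) (Fin n) F) - 1) *ᵥ v}

theorem sub_one_mulVec_mem_unipotentFiltration {U : Subgroup (GL (Fin n) F)} {u : GL (Fin n) F}
    (hu : u ∈ U) {i : ℕ} {v : Fin n → F} (hv : v ∈ unipotentFiltration U i) :
    ((u : Matrix (Fin n) (Fin n) F) - 1) *ᵥ v ∈ unipotentFiltration U (i + 1) :=
  Submodule.subset_span ⟨u, hu, v, hv, rfl⟩

theorem mulVec_mem_unipotentFiltration {U : Subgroup (GL (Fin n) F)} {g : GL (Fin n) F}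
    (hg : ∀ u ∈ U, g * u * g⁻¹ ∈ U) {i : ℕ} {v : Fin n → F} (hv : v ∈ unipotentFiltration U i) :
    (g : Matrix (Fin n) (Fin n) F) *ᵥ v ∈ unipotentFiltration U i := by
  induction i generalizing v with
  | zero => exact Submodule.mem_top
  | succ i ih =>
    rw [unipotentFiltration] at hv
    induction hv using Submodule.span_induction with
    | mem w hw =>
      obtain ⟨u, hu, v, hv, rfl⟩ := hw
      have : (g : Matrix (Fin n) (Fin n) F) * (u - 1) =
          (((g * u * g⁻¹ : GL (Fin n) F) : Matrix (Fin n) (Fin n) F) - 1) * g := by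
        rw [sub_mul, ← Units.val_mul, inv_mul_cancel_right, mul_sub, Units.val_mul, one_mul, mul_one]
      rw [mulVec_mulVec, this, ← mulVec_mulVec]
      exact sub_one_mulVec_mem_unipotentFiltration (hg u hu) (ih hv)
    | zero => rw [mulVec_zero]; exact zero_mem _
    | add x y _ _ hx hy => rw [mulVec_add]; exact add_mem hx hy
    | smul c x _ hx => rw [mulVec_smul]; exact Submodule.smul_mem _ c hx

/-- Traces of products `a * b`, with `a` in the augmentation ideal and `b` in the linear span of a
group of unipotent matrices, vanish. -/
theorem trace_mul_eq_zero_of_mem_span [CharZero F] {U : Subgroup (GL (Fin n) F)}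
    (hU : ∀ u ∈ U, IsNilpotent ((u : Matrix (Fin n) (Fin n) F) - 1))
    {a b : Matrix (Fin n) (Fin n) F}
    (ha : a ∈ Submodule.span F {w | ∃ u ∈ U, w = (u : Matrix (Fin n) (Fin n) F) - 1})
    (hb : b ∈ Submodule.span F {w | ∃ u ∈ U, w = (u : Matrix (Fin n) (Fin n) F)}) :
    (a * b).trace = 0 := by
  have htr : ∀ u ∈ U, (u : Matrix (Fin n) (Fin n) F).trace = (1 : Matrix (Fin n) (Fin n) F).trace := by
    intro u hu
    rw [← sub_eq_zero, ← Matrix.trace_sub]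
    exact (Matrix.isNilpotent_trace_of_isNilpotent (hU u hu)).eq_zero
  induction ha using Submodule.span_induction with
  | mem w hw =>
    obtain ⟨u, hu, rfl⟩ := hw
    induction hb using Submodule.span_induction with
    | mem w hw =>
      obtain ⟨v, hv, rfl⟩ := hw
      rw [sub_mul, one_mul, ← Units.val_mul, Matrix.trace_sub, htr _ (mul_mem hu hv), htr _ hv, sub_self]
    | zero => simp
    | add x y _ _ hx hy => rw [mul_add, Matrix.trace_add, hx, hy, add_zero]
    | smul c x _ hx => rw [mul_smul_comm, Matrix.trace_smul, hx, smul_zero]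
  | zero => simp
  | add x y _ _ hx hy => rw [add_mul, Matrix.trace_add, hx, hy, add_zero]
  | smul c x _ hx => rw [smul_mul_assoc, Matrix.trace_smul, hx, smul_zero]

theorem isNilpotent_of_mem_span_sub_one [CharZero F] {U : Subgroup (GL (Fin n) F)}
    (hU : ∀ u ∈ U, IsNilpotent ((u : Matrix (Fin n) (Fin n) F) - 1))
    {a : Matrix (Fin n) (Fin n) F}
    (ha : a ∈ Submodule.span F {w | ∃ u ∈ U, w = (u : Matrix (Fin n) (Fin n) F) - 1}) :
    IsNilpotent a := by
  set S : Set (Matrix (Fin n) (Fin n) F) := {w | ∃ u ∈ U, w = (u : Matrix (Fin n) (Fin n) F)} with hS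
  have h1 : (1 : Matrix (Fin n) (Fin n) F) ∈ Submodule.span F S :=
    Submodule.subset_span ⟨1, one_mem U, rfl⟩
  have hmul : ∀ x y, x ∈ Submodule.span F S → y ∈ Submodule.span F S → x * y ∈ Submodule.span F S := by
    intro x y hx hy
    have := Submodule.mul_mem_mul hx hy
    rw [Submodule.span_mul_span] at this
    refine Submodule.span_mono ?_ this
    rintro _ ⟨_, ⟨u, hu, rfl⟩, _, ⟨v, hv, rfl⟩, rfl⟩
    exact ⟨u * v, mul_mem hu hv, rfl⟩
  have haS : a ∈ Submodule.span F S := by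
    refine Submodule.span_le.2 ?_ ha
    rintro _ ⟨u, hu, rfl⟩
    exact sub_mem (Submodule.subset_span ⟨u, hu, rfl⟩) h1
  refine isNilpotent_of_forall_trace_mul_aeval_eq_zero a fun p ↦
    trace_mul_eq_zero_of_mem_span hU ha ?_
  let A : Subalgebra F (Matrix (Fin n) (Fin n) F) := (Submodule.span F S).toSubalgebra h1 hmul
  exact Algebra.adjoin_le (S := A) (Set.singleton_subset_iff.2 haS)
    (Polynomial.aeval_mem_adjoin_singleton F a)

attribute [local instance] LieRing.ofAssociativeRing in
/-- Kolchin's theorem in characteristic zero. -/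
theorem exists_unipotentFiltration_eq_bot [CharZero F] {U : Subgroup (GL (Fin n) F)}
    (hU : ∀ u ∈ U, IsNilpotent ((u : Matrix (Fin n) (Fin n) F) - 1)) :
    ∃ N, unipotentFiltration U N = ⊥ := by
  set I := Submodule.span F {w | ∃ u ∈ U, w = (u : Matrix (Fin n) (Fin n) F) - 1} with hI
  have hmem : ∀ u ∈ U, (u : Matrix (Fin n) (Fin n) F) - 1 ∈ I := fun u hu ↦
    Submodule.subset_span ⟨u, hu, rfl⟩
  have hmul : ∀ x y, x ∈ I → y ∈ I → x * y ∈ I := by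
    intro x y hx hy
    have := Submodule.mul_mem_mul hx hy
    rw [hI, Submodule.span_mul_span] at this
    refine Submodule.span_le.2 ?_ this
    rintro _ ⟨_, ⟨u, hu, rfl⟩, _, ⟨v, hv, rfl⟩, rfl⟩
    have : ((u : Matrix (Fin n) (Fin n) F) - 1) * ((v : Matrix (Fin n) (Fin n) F) - 1) =
        (((u * v : GL (Fin n) F) : Matrix (Fin n) (Fin n) F) - 1) - (u - 1) - (v - 1) := by
      rw [Units.val_mul]; noncomm_ring
    change ((u : Matrix (Fin n) (Fin n) F) - 1) * ((v : Matrix (Fin n) (Fin n) F) - 1) ∈ I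
    rw [this]
    exact sub_mem (sub_mem (hmem _ (mul_mem hu hv)) (hmem u hu)) (hmem v hv)
  let L : LieSubalgebra F (Module.End F (Fin n → F)) :=
    { I.map (Matrix.toLin' : Matrix (Fin n) (Fin n) F ≃ₗ[F] _).toLinearMap with
      lie_mem' := by
        rintro _ _ ⟨x, hx, rfl⟩ ⟨y, hy, rfl⟩
        refine ⟨x * y - y * x, sub_mem (hmul x y hx hy) (hmul y x hy hx), ?_⟩
        simp [Matrix.toLin'_mul, LieRing.of_associative_ring_bracket, Module.End.mul_eq_comp] }
  have hnil : LieModule.IsNilpotent L (Fin n → F) := by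
    rw [LieModule.isNilpotent_iff_forall' (R := F)]
    rintro ⟨_, x, hx, rfl⟩
    have := (isNilpotent_of_mem_span_sub_one hU hx).map
      (Matrix.toLinAlgEquiv' : Matrix (Fin n) (Fin n) F ≃ₐ[F] _)
    exact this
  obtain ⟨N, hN⟩ := hnil.nilpotent F
  refine ⟨N, ?_⟩
  have hle : ∀ i, unipotentFiltration U i ≤
      (LieModule.lowerCentralSeries F L (Fin n → F) i).toSubmodule := by
    intro i
    induction i with
    | zero => simp
    | succ i ih =>
      refine Submodule.span_le.2 ?_
      rintro _ ⟨u, hu, v, hv, rfl⟩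
      rw [LieModule.lowerCentralSeries_succ]
      exact LieSubmodule.lie_mem_lie
        (x := (⟨_, Submodule.mem_map_of_mem (hmem u hu)⟩ : L)) (LieSubmodule.mem_top _) (ih hv)
  have := hle N
  rw [hN] at this
  simpa using this

open scoped commutatorElement

/-- The product of an element of a unipotent group with a unipotent element normalizing that group
is unipotent. -/
theorem isNilpotent_mul_sub_one [CharZero F] {U : Subgroup (GL (Fin n) F)}
    (hU : ∀ u ∈ U, IsNilpotent ((u : Matrix (Fin n) (Fin n) F) - 1)) {u g : GL (Fin n) F}
    (hu : u ∈ U) (hg : IsNilpotent ((g : Matrix (Fin n) (Fin n) F) - 1))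
    (hgU : ∀ u ∈ U, g * u * g⁻¹ ∈ U) :
    IsNilpotent (((u * g : GL (Fin n) F) : Matrix (Fin n) (Fin n) F) - 1) := by
  obtain ⟨N, hN⟩ := exists_unipotentFiltration_eq_bot hU
  obtain ⟨m, hm⟩ := hg
  set w : Matrix (Fin n) (Fin n) F := ((u * g : GL (Fin n) F) : Matrix (Fin n) (Fin n) F) with hw
  have huU : ∀ v ∈ U, u * v * u⁻¹ ∈ U := fun v hv ↦ mul_mem (mul_mem hu hv) (inv_mem hu)
  have hg1 : ∀ i, ∀ v ∈ unipotentFiltration U i,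
      ((g : Matrix (Fin n) (Fin n) F) - 1) *ᵥ v ∈ unipotentFiltration U i := by
    intro i v hv
    rw [sub_mulVec, one_mulVec]
    exact sub_mem (mulVec_mem_unipotentFiltration hgU hv) hv
  have hw1 : ∀ i, ∀ v ∈ unipotentFiltration U i, (w - 1) *ᵥ v ∈ unipotentFiltration U i := by
    intro i v hv
    rw [sub_mulVec, one_mulVec, hw, Units.val_mul, ← mulVec_mulVec]
    exact sub_mem (mulVec_mem_unipotentFiltration huU (mulVec_mem_unipotentFiltration hgU hv)) hv
  have hgk : ∀ k i, ∀ v ∈ unipotentFiltration U i,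
      ((g : Matrix (Fin n) (Fin n) F) - 1) ^ k *ᵥ v ∈ unipotentFiltration U i := by
    intro k i v hv
    induction k with
    | zero => simpa using hv
    | succ k ih => rw [pow_succ', ← mulVec_mulVec]; exact hg1 i _ ih
  have hcong : ∀ k i, ∀ v ∈ unipotentFiltration U i,
      (w - 1) ^ k *ᵥ v - ((g : Matrix (Fin n) (Fin n) F) - 1) ^ k *ᵥ v ∈
        unipotentFiltration U (i + 1) := by
    intro k i v hv
    induction k with
    | zero => simp
    | succ k ih =>
      have : (w - 1) ^ (k + 1) *ᵥ v - ((g : Matrix (Fin n) (Fin n) F) - 1) ^ (k + 1) *ᵥ v =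
          (w - 1) *ᵥ ((w - 1) ^ k *ᵥ v - ((g : Matrix (Fin n) (Fin n) F) - 1) ^ k *ᵥ v) +
          ((u : Matrix (Fin n) (Fin n) F) - 1) *ᵥ ((g : Matrix (Fin n) (Fin n) F) *ᵥ
            (((g : Matrix (Fin n) (Fin n) F) - 1) ^ k *ᵥ v)) := by
        have hsub : ∀ z, (w - 1) *ᵥ ((w - 1) ^ k *ᵥ v - z) =
            (w - 1) *ᵥ ((w - 1) ^ k *ᵥ v) - (w - 1) *ᵥ z := fun z ↦ mulVec_sub _ _ _
        have hwg : ((u : Matrix (Fin n) (Fin n) F) - 1) * g = (w - 1) - (g - 1) := by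
          rw [hw, Units.val_mul]; noncomm_ring
        rw [mulVec_mulVec (((g : Matrix (Fin n) (Fin n) F) - 1) ^ k *ᵥ v), hsub, hwg, sub_mulVec (w - 1),
          pow_succ', pow_succ', ← mulVec_mulVec, ← mulVec_mulVec]
        abel
      rw [this]
      exact add_mem (hw1 _ _ ih) (sub_one_mulVec_mem_unipotentFiltration hu
        (mulVec_mem_unipotentFiltration hgU (hgk k i v hv)))
  have hpow : ∀ i v, (w - 1) ^ (m * i) *ᵥ v ∈ unipotentFiltration U i := by
    intro i v
    induction i with
    | zero => exact Submodule.mem_top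
    | succ i ih =>
      have := hcong m i _ ih
      rw [hm, zero_mulVec, sub_zero, mulVec_mulVec, ← pow_add] at this
      rwa [mul_add_one, add_comm (m * i)]
  refine ⟨m * N, Matrix.ext_of_mulVec_single fun i ↦ ?_⟩
  have := hpow N (Pi.single i 1)
  rwa [hN, Submodule.mem_bot, ← zero_mulVec (Pi.single i 1)] at this

theorem isNilpotent_zpow_sub_one {x : GL (Fin n) F}
    (hx : IsNilpotent ((x : Matrix (Fin n) (Fin n) F) - 1)) (k : ℤ) :
    IsNilpotent (((x ^ k : GL (Fin n) F) : Matrix (Fin n) (Fin n) F) - 1) := by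
  have hpow : ∀ k : ℕ, IsNilpotent (((x ^ k : GL (Fin n) F) : Matrix (Fin n) (Fin n) F) - 1) := by
    intro k
    rw [Units.val_pow_eq_pow_val, ← mul_geom_sum]
    refine Commute.isNilpotent_mul_right ?_ hx
    exact Commute.sum_right _ _ _ fun i _ ↦ ((Commute.refl _).sub_left (Commute.one_left _)).pow_right i
  obtain ⟨k, rfl | rfl⟩ := k.eq_nat_or_neg
  · simpa using hpow k
  · have h : (((x ^ (-(k : ℤ)) : GL (Fin n) F) : Matrix (Fin n) (Fin n) F) - 1) =
        -(((x ^ k)⁻¹ : GL (Fin n) F) * (((x ^ k : GL (Fin n) F) : Matrix (Fin n) (Fin n) F) - 1)) := by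
      rw [mul_sub, Units.inv_mul, mul_one, neg_sub, _root_.zpow_neg, zpow_natCast]
    rw [h]
    refine (Commute.isNilpotent_mul_left ?_ (hpow k)).neg
    rw [Commute, SemiconjBy, mul_sub, sub_mul, Units.inv_mul, Units.mul_inv, mul_one, one_mul]

theorem isNilpotent_sub_one_of_mem_sup_zpowers [CharZero F] {U : Subgroup (GL (Fin n) F)}
    (hU : ∀ u ∈ U, IsNilpotent ((u : Matrix (Fin n) (Fin n) F) - 1)) {x : GL (Fin n) F}
    (hx : IsNilpotent ((x : Matrix (Fin n) (Fin n) F) - 1)) (hxU : x ∈ Subgroup.normalizer (U : Set (GL (Fin n) F)))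
    {g : GL (Fin n) F} (hg : g ∈ U ⊔ Subgroup.zpowers x) :
    IsNilpotent ((g : Matrix (Fin n) (Fin n) F) - 1) := by
  rw [← SetLike.mem_coe, Subgroup.coe_mul_of_right_le_normalizer_left _ _
    (Subgroup.zpowers_le.2 hxU)] at hg
  obtain ⟨u, hu, _, ⟨k, rfl⟩, rfl⟩ := hg
  exact isNilpotent_mul_sub_one hU hu (isNilpotent_zpow_sub_one hx k) fun v hv ↦
    (Subgroup.mem_normalizer_iff.1 (zpow_mem hxU k) v).1 hv

/-- If two unipotent elements normalize a unipotent group and commute modulo that group, then their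
product is unipotent. -/
theorem isNilpotent_mul_sub_one_of_commutator_mem [CharZero F] {U : Subgroup (GL (Fin n) F)}
    (hU : ∀ u ∈ U, IsNilpotent ((u : Matrix (Fin n) (Fin n) F) - 1)) {x y : GL (Fin n) F}
    (hx : IsNilpotent ((x : Matrix (Fin n) (Fin n) F) - 1))
    (hy : IsNilpotent ((y : Matrix (Fin n) (Fin n) F) - 1))
    (hxU : x ∈ Subgroup.normalizer (U : Set (GL (Fin n) F))) (hyU : y ∈ Subgroup.normalizer (U : Set (GL (Fin n) F)))
    (hxy : ⁅y, x⁆ ∈ U) :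
    IsNilpotent (((x * y : GL (Fin n) F) : Matrix (Fin n) (Fin n) F) - 1) := by
  have hle : U ⊔ Subgroup.zpowers x ≤
      (U ⊔ Subgroup.zpowers x).comap (MulAut.conj y).toMonoidHom := by
    refine sup_le (fun u hu ↦ ?_) (Subgroup.zpowers_le.2 ?_)
    · exact Subgroup.mem_sup_left ((Subgroup.mem_normalizer_iff.1 hyU u).1 hu)
    · have : (MulAut.conj y).toMonoidHom x = ⁅y, x⁆ * x := by
        simp [commutatorElement_def]
      rw [Subgroup.mem_comap, this]
      exact mul_mem (Subgroup.mem_sup_left hxy)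
        (Subgroup.mem_sup_right (Subgroup.mem_zpowers x))
  exact isNilpotent_mul_sub_one
    (fun g hg ↦ isNilpotent_sub_one_of_mem_sup_zpowers hU hx hxU hg)
    (Subgroup.mem_sup_right (Subgroup.mem_zpowers x)) hy fun g hg ↦ hle hg

/-- A group of unipotent matrices over a field of characteristic zero is nilpotent. -/
theorem group_isNilpotent_of_isNilpotent_sub_one [CharZero F] {U : Subgroup (GL (Fin n) F)}
    (hU : ∀ u ∈ U, IsNilpotent ((u : Matrix (Fin n) (Fin n) F) - 1)) : Group.IsNilpotent U := by
  obtain ⟨N, hN⟩ := exists_unipotentFiltration_eq_bot hU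
  have hinv : ∀ (x : U) i, ∀ v ∈ unipotentFiltration U i,
      ((x : GL (Fin n) F) : Matrix (Fin n) (Fin n) F) *ᵥ v ∈ unipotentFiltration U i :=
    fun x i v hv ↦ mulVec_mem_unipotentFiltration
      (fun u hu ↦ mul_mem (mul_mem x.2 hu) (inv_mem x.2)) hv
  let H : ℕ → Subgroup U := fun i ↦
    { carrier := {x | ∀ j, ∀ v ∈ unipotentFiltration U j,
        (((x : GL (Fin n) F) : Matrix (Fin n) (Fin n) F) - 1) *ᵥ v ∈ unipotentFiltration U (j + i)}
      one_mem' := by intro j v _; simp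
      mul_mem' := by
        intro x y hx hy j v hv
        have : (((x * y : U) : GL (Fin n) F) : Matrix (Fin n) (Fin n) F) - 1 =
            ((x : GL (Fin n) F) - 1) * ((y : GL (Fin n) F) : Matrix (Fin n) (Fin n) F) +
              ((y : GL (Fin n) F) - 1) := by
          rw [Subgroup.coe_mul, Units.val_mul]; noncomm_ring
        rw [this, add_mulVec, ← mulVec_mulVec]
        exact add_mem (hx j _ (hinv y j v hv)) (hy j v hv)
      inv_mem' := by
        intro x hx j v hv
        have : (((x⁻¹ : U) : GL (Fin n) F) : Matrix (Fin n) (Fin n) F) - 1 =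
            -(((x : GL (Fin n) F) - 1) *
              (((x⁻¹ : U) : GL (Fin n) F) : Matrix (Fin n) (Fin n) F)) := by
          rw [sub_mul, Subgroup.coe_inv, Units.mul_inv, one_mul, neg_sub]
        rw [this, neg_mulVec, ← mulVec_mulVec]
        exact neg_mem (hx j _ (hinv x⁻¹ j v hv)) }
  rw [Subgroup.nilpotent_iff_finite_descending_central_series]
  refine ⟨N, H, ⟨?_, ?_⟩, ?_⟩
  · refine (Subgroup.eq_top_iff' _).2 fun x j v hv ↦ ?_
    rw [sub_mulVec, one_mulVec]
    exact sub_mem (hinv x j v hv) hv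
  · intro x i hx y j v hv
    have hcomm : (((⁅x, y⁆ : U) : GL (Fin n) F) : Matrix (Fin n) (Fin n) F) - 1 =
        (((x : GL (Fin n) F) - 1) * ((y : GL (Fin n) F) - 1) -
          ((y : GL (Fin n) F) - 1) * ((x : GL (Fin n) F) - 1)) *
          (((x⁻¹ * y⁻¹ : U) : GL (Fin n) F) : Matrix (Fin n) (Fin n) F) := by
      have h1 : (((x : GL (Fin n) F) : Matrix (Fin n) (Fin n) F) - 1) * ((y : GL (Fin n) F) - 1) -
          ((y : GL (Fin n) F) - 1) * ((x : GL (Fin n) F) - 1) =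
          ((x * y : U) : GL (Fin n) F) - ((y * x : U) : GL (Fin n) F) := by
        rw [Subgroup.coe_mul, Subgroup.coe_mul, Units.val_mul, Units.val_mul]; noncomm_ring
      rw [h1, sub_mul, ← Units.val_mul, ← Units.val_mul, ← Subgroup.coe_mul, ← Subgroup.coe_mul,
        commutatorElement_def]
      congr 2
      · group
      · rw [show y * x * (x⁻¹ * y⁻¹) = 1 by group]; rfl
    rw [hcomm, ← mulVec_mulVec, sub_mulVec, ← mulVec_mulVec, ← mulVec_mulVec]
    have hv' := hinv (x⁻¹ * y⁻¹) j v hv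
    refine sub_mem ?_ (sub_one_mulVec_mem_unipotentFiltration (i := j + i) y.2 (hx j _ hv'))
    have := hx (j + 1) _ (sub_one_mulVec_mem_unipotentFiltration y.2 hv')
    rwa [add_right_comm] at this
  · refine (Subgroup.eq_bot_iff_forall _).2 fun x hx ↦ Subtype.ext (Units.ext ?_)
    refine Matrix.ext_of_mulVec_single fun i ↦ ?_
    have := hx 0 (Pi.single i 1) Submodule.mem_top
    rwa [zero_add, hN, Submodule.mem_bot, sub_mulVec, sub_eq_zero] at this

theorem Matrix.pow_eq_zero_of_isNilpotent {a : Matrix (Fin n) (Fin n) F} (ha : IsNilpotent a) :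
    a ^ n = 0 := by
  have h := (Matrix.isNilpotent_charpoly_sub_pow_of_isNilpotent ha).eq_zero
  rw [sub_eq_zero, Fintype.card_fin] at h
  simpa [h] using Matrix.aeval_self_charpoly a

theorem IsDiagonalizableMat.conj {m : Matrix (Fin n) (Fin n) F} (hm : IsDiagonalizableMat m)
    (g : GL (Fin n) F) :
    IsDiagonalizableMat ((g : Matrix (Fin n) (Fin n) F) * m * ((g⁻¹ : GL (Fin n) F) : Matrix (Fin n) (Fin n) F)) := by
  obtain ⟨P, hP⟩ := hm
  let ψ := (algebraMap F (AlgebraicClosure F)).mapMatrix (m := Fin n)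
  let γ : GL (Fin n) (AlgebraicClosure F) := Units.map ψ.toMonoidHom g
  refine ⟨γ * P, ?_⟩
  have h1 : ψ (g : Matrix (Fin n) (Fin n) F) = γ := rfl
  have h2 : ψ ((g⁻¹ : GL (Fin n) F) : Matrix (Fin n) (Fin n) F) = (γ⁻¹ : GL _ _) := rfl
  change (((γ * P)⁻¹ : GL (Fin n) (AlgebraicClosure F)) *
    ψ ((g : Matrix (Fin n) (Fin n) F) * m * ((g⁻¹ : GL (Fin n) F) : Matrix (Fin n) (Fin n) F)) *
    ((γ * P : GL (Fin n) (AlgebraicClosure F)) :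
      Matrix (Fin n) (Fin n) (AlgebraicClosure F))).IsDiag
  rw [map_mul, map_mul, h1, h2, _root_.mul_inv_rev, Units.val_mul, Units.val_mul]
  convert hP using 1
  simp only [Matrix.mul_assoc]
  rw [Units.inv_mul_cancel_left, Units.inv_mul_cancel_left]
  rfl

theorem commute_of_mem_closure {M : Type*} [Group M] {S T : Set M}
    (h : ∀ a ∈ S, ∀ b ∈ T, Commute a b) {a b : M} (ha : a ∈ Subgroup.closure S)
    (hb : b ∈ Subgroup.closure T) : Commute a b := by
  have hT : Subgroup.closure T ≤ Subgroup.centralizer S :=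
    (Subgroup.closure_le _).2 fun b hb ↦ Subgroup.mem_centralizer_iff.2 fun a ha ↦ h a ha b hb
  have hS : Subgroup.closure S ≤ Subgroup.centralizer (Subgroup.closure T) :=
    (Subgroup.closure_le _).2 fun a ha ↦ Subgroup.mem_centralizer_iff.2 fun b hb ↦
      (Subgroup.mem_centralizer_iff.1 (hT hb) a ha).symm
  exact (Subgroup.mem_centralizer_iff.1 (hS ha) b hb).symm

theorem commutatorElement_mul_mul_of_commute {M : Type*} [Group M] {a b a' b' : M}
    (haa : Commute a a') (hab : Commute a b) (hab' : Commute a b') (hb : Commute a' b)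
    (hb' : Commute a' b') : ⁅a * b, a' * b'⁆ = ⁅b, b'⁆ := by
  have h1 : a * b * (a' * b') = a * a' * (b * b') := by
    rw [mul_assoc, ← mul_assoc b, ← hb.eq, mul_assoc a', ← mul_assoc]
  have h2 : a' * b' * (a * b) = a * a' * (b' * b) := by
    rw [mul_assoc, ← mul_assoc b', ← hab'.eq, mul_assoc a, ← mul_assoc, haa.eq]
  have h3 : Commute (a * a') (b * b' * (b' * b)⁻¹) :=
    ((hab.mul_right hab').mul_right (hab'.mul_right hab).inv_right).mul_left
      ((hb.mul_right hb').mul_right (hb'.mul_right hb).inv_right)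
  have h4 : ∀ x y : M, ⁅x, y⁆ = x * y * (y * x)⁻¹ := fun x y ↦ by
    rw [commutatorElement_def]; group
  rw [h4, h4, h1, h2, _root_.mul_inv_rev, mul_assoc (a * a'), ← mul_assoc (b * b'), ← mul_assoc,
    h3.eq, mul_inv_cancel_right]

/-- A subgroup of the product of an abelian group with a unipotent group centralizing it is
nilpotent with unipotent derived subgroup. -/
theorem isNilpotent_and_commutator_of_le_sup [CharZero F] {H D U : Subgroup (GL (Fin n) F)}
    (hD : ∀ a ∈ D, ∀ b ∈ D, a * b = b * a)
    (hU : ∀ u ∈ U, IsNilpotent ((u : Matrix (Fin n) (Fin n) F) - 1))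
    (hDU : ∀ a ∈ D, ∀ b ∈ U, Commute a b) (hH : H ≤ D ⊔ U) :
    Group.IsNilpotent H ∧
      ∀ x ∈ ⁅H, H⁆, IsNilpotent ((x : Matrix (Fin n) (Fin n) F) - 1) := by
  let f : D × U →* GL (Fin n) F :=
    MonoidHom.noncommCoprod D.subtype U.subtype fun a b ↦ hDU a a.2 b b.2
  have hf : H ≤ f.range := by
    refine hH.trans_eq ?_
    conv_lhs => rw [← D.range_subtype, ← U.range_subtype]
    exact (MonoidHom.noncommCoprod_range _ _ _).symm
  constructor
  · let _ : CommGroup D :=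
      { (inferInstance : Group D) with mul_comm := fun a b ↦ Subtype.ext (hD a a.2 b b.2) }
    have : Group.IsNilpotent U := group_isNilpotent_of_isNilpotent_sub_one hU
    have : Group.IsNilpotent f.range :=
      Group.nilpotent_of_surjective f.rangeRestrict f.rangeRestrict_surjective
    exact (Group.isNilpotent_congr (Subgroup.subgroupOfEquivOfLe hf)).1 inferInstance
  · have hle : ⁅H, H⁆ ≤ U := by
      rw [Subgroup.commutator_le]
      intro x hx y hy
      obtain ⟨⟨a, b⟩, rfl⟩ := hf hx
      obtain ⟨⟨a', b'⟩, rfl⟩ := hf hy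
      change ⁅(a : GL (Fin n) F) * b, (a' : GL (Fin n) F) * b'⁆ ∈ U
      rw [commutatorElement_mul_mul_of_commute (hD a a.2 a' a'.2) (hDU a a.2 b b.2)
        (hDU a a.2 b' b'.2) (hDU a' a'.2 b b.2) (hDU a' a'.2 b' b'.2)]
      exact (⁅b, b'⁆ : U).2
    exact fun x hx ↦ hU x (hle hx)

/-- The functions `d` and `u` give the diagonalizable and the unipotent part of each invertible
matrix in its unique multiplicative Jordan decomposition. -/
structure IsJordanDecomposition (d u : GL (Fin n) F → GL (Fin n) F) : Prop where
  eq_mul : ∀ h, h = d h * u h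
  commute : ∀ h, Commute (d h) (u h)
  diagonalizable : ∀ h, IsDiagonalizableMat (d h : Matrix (Fin n) (Fin n) F)
  unipotent : ∀ h, IsNilpotent ((u h : Matrix (Fin n) (Fin n) F) - 1)
  unique : ∀ h s v : GL (Fin n) F, h = s * v → Commute s v →
    IsDiagonalizableMat (s : Matrix (Fin n) (Fin n) F) →
    IsNilpotent ((v : Matrix (Fin n) (Fin n) F) - 1) → s = d h ∧ v = u h

namespace IsJordanDecomposition

theorem conj {d u : GL (Fin n) F → GL (Fin n) F} (J : IsJordanDecomposition d u)
    (g h : GL (Fin n) F) : d (g * h * g⁻¹) = g * d h * g⁻¹ := by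
  refine ((J.unique (g * h * g⁻¹) (g * d h * g⁻¹) (g * u h * g⁻¹) ?_ ?_ ?_ ?_).1).symm
  · conv_lhs => rw [J.eq_mul h]
    group
  · exact (J.commute h).map (MulAut.conj g)
  · simpa only [Units.val_mul] using (J.diagonalizable h).conj g
  · obtain ⟨k, hk⟩ := J.unipotent h
    have h1 : ((g * u h * g⁻¹ : GL (Fin n) F) : Matrix (Fin n) (Fin n) F) - 1 =
        g * ((u h : Matrix (Fin n) (Fin n) F) - 1) * ((g⁻¹ : GL (Fin n) F) : Matrix (Fin n) (Fin n) F) := by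
      rw [mul_sub, sub_mul, mul_one, Units.mul_inv, Units.val_mul, Units.val_mul]
    refine ⟨k, ?_⟩
    rw [h1, Units.conj_pow, hk, mul_zero, zero_mul]

theorem commute_left {d u : GL (Fin n) F → GL (Fin n) F} (J : IsJordanDecomposition d u)
    {c h : GL (Fin n) F} (hc : Commute c h) : Commute c (d h) := by
  have := J.conj c h
  rw [hc.eq, mul_inv_cancel_right] at this
  exact (mul_inv_eq_iff_eq_mul.1 this.symm)

theorem unipotent_eq {d u : GL (Fin n) F → GL (Fin n) F} (J : IsJordanDecomposition d u)
    (h : GL (Fin n) F) : u h = (d h)⁻¹ * h := by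
  rw [eq_inv_mul_iff_mul_eq, ← J.eq_mul]

/-- In a nilpotent linear group with unipotent derived subgroup, diagonalizable parts centralize
the group. -/
theorem commute_of_isNilpotent {d u : GL (Fin n) F → GL (Fin n) F} (J : IsJordanDecomposition d u)
    [CharZero F] {H : Subgroup (GL (Fin n) F)} [hH : Group.IsNilpotent H]
    (hder : ∀ x ∈ ⁅H, H⁆, IsNilpotent ((x : Matrix (Fin n) (Fin n) F) - 1))
    {s x : GL (Fin n) F} (hs : s ∈ H) (hx : x ∈ H) : Commute (d s) x := by
  suffices key : ∀ i, ∀ x : H, x ∈ Subgroup.upperCentralSeries H i → ∀ s ∈ H,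
      Commute (d s) (x : GL (Fin n) F) by
    obtain ⟨c, hc⟩ := hH.nilpotent
    exact key c ⟨x, hx⟩ (hc ▸ Subgroup.mem_top _) s hs
  intro i
  induction i with
  | zero =>
    intro x hx s _
    rw [Subgroup.upperCentralSeries_zero, Subgroup.mem_bot] at hx
    rw [hx]
    exact Commute.one_right _
  | succ i ih =>
    intro x hx s hs
    have hz : ⁅x, (⟨s, hs⟩ : H)⁆ ∈ Subgroup.upperCentralSeries H i :=
      Subgroup.mem_upperCentralSeries_succ_iff.1 hx _
    set V : Subgroup (GL (Fin n) F) := (Subgroup.upperCentralSeries H i).map H.subtype ⊓ ⁅H, H⁆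
    have hVcomm : ∀ v ∈ V, Commute (d s) v := by
      rintro v ⟨⟨v, hv, rfl⟩, _⟩
      exact ih v hv s hs
    have hVs : ∀ v ∈ V, s * v * s⁻¹ ∈ V := by
      rintro v ⟨⟨v, hv, rfl⟩, hv'⟩
      refine ⟨Subgroup.mem_map_of_mem H.subtype (Subgroup.Normal.conj_mem
        (inferInstance : (Subgroup.upperCentralSeries H i).Normal) v hv ⟨s, hs⟩), ?_⟩
      change s * v * s⁻¹ ∈ ⁅H, H⁆
      have : s * v * s⁻¹ = ⁅s, (v : GL (Fin n) F)⁆ * v := by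
        rw [commutatorElement_def, inv_mul_cancel_right]
      rw [this]
      exact mul_mem (Subgroup.commutator_mem_commutator hs v.2) hv'
    have hzV : ⁅(x : GL (Fin n) F), s⁆ ∈ V :=
      ⟨Subgroup.mem_map_of_mem H.subtype hz, Subgroup.commutator_mem_commutator x.2 hs⟩
    have huV : ∀ v ∈ V, u s * v * (u s)⁻¹ ∈ V := by
      intro v hv
      have h1 : u s * v * (u s)⁻¹ = (d s)⁻¹ * (s * v * s⁻¹) * d s := by
        rw [J.unipotent_eq]; group
      rw [h1, (hVcomm _ (hVs v hv)).inv_left.eq, inv_mul_cancel_right]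
      exact hVs v hv
    have hnil := isNilpotent_mul_sub_one (U := V) (fun v hv ↦ hder v hv.2) hzV (J.unipotent s) huV
    have hconj : (x : GL (Fin n) F) * s * (x : GL (Fin n) F)⁻¹ =
        d s * (⁅(x : GL (Fin n) F), s⁆ * u s) := by
      rw [← mul_assoc (d s), (hVcomm _ hzV).eq, mul_assoc _ (d s), ← J.eq_mul, commutatorElement_def,
        inv_mul_cancel_right]
    have := (J.unique _ _ _ hconj ((hVcomm _ hzV).mul_right (J.commute s))
      (J.diagonalizable s) hnil).1
    rw [J.conj] at this
    exact eq_mul_inv_iff_mul_eq.1 this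

theorem forall_mem_closure_isNilpotent {d u : GL (Fin n) F → GL (Fin n) F} (J : IsJordanDecomposition d u)
    [CharZero F] {H : Subgroup (GL (Fin n) F)}
    (hder : ∀ x ∈ ⁅H, H⁆, IsNilpotent ((x : Matrix (Fin n) (Fin n) F) - 1))
    (hcomm : ∀ s ∈ H, ∀ x ∈ H, Commute (d s) x) {x : GL (Fin n) F}
    (hx : x ∈ Subgroup.closure (u '' H)) :
    IsNilpotent ((x : Matrix (Fin n) (Fin n) F) - 1) := by
  have hHH : ∀ s ∈ H, ∀ v ∈ ⁅H, H⁆, s * v * s⁻¹ ∈ ⁅H, H⁆ := by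
    intro s hs v hv
    have : s * v * s⁻¹ = ⁅s, v⁆ * v := by rw [commutatorElement_def, inv_mul_cancel_right]
    exact this ▸ mul_mem
      (Subgroup.commutator_mem_commutator hs (Subgroup.commutator_le_self H hv)) hv
  have hDH : ∀ c ∈ Subgroup.closure (d '' H), ∀ y ∈ H, Commute c y := by
    intro c hc y hy
    refine commute_of_mem_closure (T := H) ?_ hc (Subgroup.subset_closure hy)
    rintro _ ⟨s, hs, rfl⟩ y hy
    exact hcomm s hs y hy
  have hDD : ∀ c ∈ Subgroup.closure (d '' H), ∀ e ∈ Subgroup.closure (d '' H), Commute c e := by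
    refine fun c hc e he ↦ commute_of_mem_closure ?_ hc he
    rintro _ ⟨s, hs, rfl⟩ _ ⟨t, ht, rfl⟩
    exact J.commute_left (hcomm s hs t ht)
  have hnorm : ∀ c ∈ Subgroup.closure (d '' H), ∀ s ∈ H,
      c⁻¹ * s ∈ Subgroup.normalizer ((⁅H, H⁆ : Subgroup (GL (Fin n) F)) : Set (GL (Fin n) F)) := by
    intro c hc s hs
    refine mul_mem (inv_mem (Subgroup.centralizer_le_normalizer _ ?_)) ?_
    · exact Subgroup.mem_centralizer_iff.2 fun v hv ↦
        (hDH c hc v (Subgroup.commutator_le_self H hv)).eq.symm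
    · refine Subgroup.mem_normalizer_iff.2 fun v ↦ ⟨hHH s hs v, fun hv ↦ ?_⟩
      simpa [mul_assoc] using hHH s⁻¹ (inv_mem hs) _ hv
  suffices key : IsNilpotent ((x : Matrix (Fin n) (Fin n) F) - 1) ∧
      ∃ c ∈ Subgroup.closure (d '' H), ∃ s ∈ H, x = c⁻¹ * s from key.1
  induction hx using Subgroup.closure_induction with
  | mem x hx =>
    obtain ⟨s, hs, rfl⟩ := hx
    exact ⟨J.unipotent s, d s, Subgroup.subset_closure ⟨s, hs, rfl⟩, s, hs, J.unipotent_eq s⟩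
  | one => exact ⟨by simp, 1, one_mem _, 1, one_mem _, by simp⟩
  | mul x y _ _ hx hy =>
    obtain ⟨hx, c, hc, s, hs, rfl⟩ := hx
    obtain ⟨hy, e, he, t, ht, rfl⟩ := hy
    refine ⟨isNilpotent_mul_sub_one_of_commutator_mem hder hx hy (hnorm c hc s hs)
      (hnorm e he t ht) ?_, c * e, mul_mem hc he, s * t, mul_mem hs ht, ?_⟩
    · rw [commutatorElement_mul_mul_of_commute (hDD e he c hc).inv_inv (hDH e he t ht).inv_left
        (hDH e he s hs).inv_left (hDH c hc t ht).inv_left (hDH c hc s hs).inv_left]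
      exact Subgroup.commutator_mem_commutator ht hs
    · rw [(hDD c hc e he).eq, _root_.mul_inv_rev, mul_assoc, mul_assoc, ← mul_assoc s,
        ← (hDH e he s hs).inv_left.eq, mul_assoc]
  | inv x _ hx =>
    obtain ⟨hx, c, hc, s, hs, rfl⟩ := hx
    refine ⟨by simpa using isNilpotent_zpow_sub_one hx (-1), c⁻¹, inv_mem hc, s⁻¹, inv_mem hs, ?_⟩
    rw [_root_.mul_inv_rev, (hDH c hc s hs).inv_inv.inv_left.eq]

end IsJordanDecomposition

/-- The subgroup generated by a set `S` of invertible matrices is nilpotent with unipotent derived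
subgroup if and only if the diagonalizable parts of `S` generate an abelian group, the unipotent
parts of `S` generate a unipotent group, and the two kinds of parts commute. -/
theorem IsJordanDecomposition.closure_isNilpotent_iff [CharZero F]
    {d u : GL (Fin n) F → GL (Fin n) F} (J : IsJordanDecomposition d u) (S : Set (GL (Fin n) F)) :
    (Group.IsNilpotent (Subgroup.closure S) ∧
      ∀ x ∈ ⁅Subgroup.closure S, Subgroup.closure S⁆,
        IsNilpotent ((x : Matrix (Fin n) (Fin n) F) - 1)) ↔
    ((∀ a ∈ Subgroup.closure (d '' S), ∀ b ∈ Subgroup.closure (d '' S), a * b = b * a) ∧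
      (∀ x ∈ Subgroup.closure (u '' S), IsNilpotent ((x : Matrix (Fin n) (Fin n) F) - 1)) ∧
      (∀ a ∈ d '' S, ∀ b ∈ u '' S, a * b = b * a)) := by
  constructor
  · rintro ⟨hnil, hder⟩
    have hcomm : ∀ s ∈ Subgroup.closure S, ∀ x ∈ Subgroup.closure S, Commute (d s) x :=
      fun s hs x hx ↦ J.commute_of_isNilpotent hder hs hx
    have hSd : ∀ s ∈ S, ∀ t ∈ S, Commute (d s) (d t) := fun s hs t ht ↦
      J.commute_left (hcomm s (Subgroup.subset_closure hs) t (Subgroup.subset_closure ht))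
    refine ⟨?_, fun x hx ↦ J.forall_mem_closure_isNilpotent hder hcomm
      (Subgroup.closure_mono (Set.image_mono Subgroup.subset_closure) hx), ?_⟩
    · refine fun a ha b hb ↦ commute_of_mem_closure ?_ ha hb
      rintro _ ⟨s, hs, rfl⟩ _ ⟨t, ht, rfl⟩
      exact hSd s hs t ht
    · rintro _ ⟨s, hs, rfl⟩ _ ⟨t, ht, rfl⟩
      rw [J.unipotent_eq t]
      exact ((hSd s hs t ht).inv_right.mul_right
        (hcomm s (Subgroup.subset_closure hs) t (Subgroup.subset_closure ht))).eq
  · rintro ⟨hD, hU, hDU⟩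
    refine isNilpotent_and_commutator_of_le_sup hD hU
      (fun a ha b hb ↦ commute_of_mem_closure hDU ha hb) ?_
    rw [Subgroup.closure_le]
    intro s hs
    rw [J.eq_mul s]
    exact mul_mem (Subgroup.mem_sup_left (Subgroup.subset_closure ⟨s, hs, rfl⟩))
      (Subgroup.mem_sup_right (Subgroup.subset_closure ⟨s, hs, rfl⟩))

end UnipotentGroups

/-- Given the multiplicative Jordan decomposition `h = d h * u h` (characteristic zero),
the normal closure `H = ⟨K^G⟩` of a finite `K ⊆ G` is nilpotent with `H'` unipotent
iff `⟨K_d^G⟩` is abelian, `⟨K_u^G⟩` is unipotent, and `[K_d^G, K_u^G] = 1`. -/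
theorem stmt9 {n : ℕ} {F : Type*} [Field F] [CharZero F]
    (d u : GL (Fin n) F → GL (Fin n) F)
    (hdu : ∀ h, h = d h * u h)
    (hcomm : ∀ h, d h * u h = u h * d h)
    (hd : ∀ h, IsDiagonalizableMat ((d h : Matrix (Fin n) (Fin n) F)))
    (hu : ∀ h, ((u h : Matrix (Fin n) (Fin n) F) - 1) ^ n = 0)
    (huniq : ∀ h s v : GL (Fin n) F, h = s * v → s * v = v * s →
      IsDiagonalizableMat ((s : Matrix (Fin n) (Fin n) F)) →
      ((v : Matrix (Fin n) (Fin n) F) - 1) ^ n = 0 → s = d h ∧ v = u h)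
    (G : Subgroup (GL (Fin n) F)) (K : Set (GL (Fin n) F)) (hKG : K ⊆ G) (hKfin : K.Finite) :
    (Group.IsNilpotent (Subgroup.closure {x | ∃ h ∈ K, ∃ g ∈ G, x = g⁻¹ * h * g}) ∧
      ∀ x ∈ ⁅Subgroup.closure {x | ∃ h ∈ K, ∃ g ∈ G, x = g⁻¹ * h * g},
          Subgroup.closure {x | ∃ h ∈ K, ∃ g ∈ G, x = g⁻¹ * h * g}⁆,
        ((x : Matrix (Fin n) (Fin n) F) - 1) ^ n = 0) ↔
    ((∀ a ∈ Subgroup.closure {x | ∃ h ∈ K, ∃ g ∈ G, x = d (g⁻¹ * h * g)},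
        ∀ b ∈ Subgroup.closure {x | ∃ h ∈ K, ∃ g ∈ G, x = d (g⁻¹ * h * g)}, a * b = b * a) ∧
      (∀ x ∈ Subgroup.closure {x | ∃ h ∈ K, ∃ g ∈ G, x = u (g⁻¹ * h * g)},
        ((x : Matrix (Fin n) (Fin n) F) - 1) ^ n = 0) ∧
      (∀ a ∈ {x | ∃ h ∈ K, ∃ g ∈ G, x = d (g⁻¹ * h * g)},
        ∀ b ∈ {x | ∃ h ∈ K, ∃ g ∈ G, x = u (g⁻¹ * h * g)}, a * b = b * a)) := by
  have hnil : ∀ a : Matrix (Fin n) (Fin n) F, a ^ n = 0 ↔ IsNilpotent a :=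
    fun a ↦ ⟨fun h ↦ ⟨n, h⟩, Matrix.pow_eq_zero_of_isNilpotent⟩
  have J : IsJordanDecomposition d u :=
    ⟨hdu, hcomm, hd, fun h ↦ (hnil _).1 (hu h), fun h s v h1 h2 h3 h4 ↦
      huniq h s v h1 h2 h3 ((hnil _).2 h4)⟩
  have himage : ∀ f : GL (Fin n) F → GL (Fin n) F,
      {x | ∃ h ∈ K, ∃ g ∈ G, x = f (g⁻¹ * h * g)} =
        f '' {x | ∃ h ∈ K, ∃ g ∈ G, x = g⁻¹ * h * g} := by
    intro f
    ext x
    constructor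
    · rintro ⟨h, hh, g, hg, rfl⟩
      exact ⟨_, ⟨h, hh, g, hg, rfl⟩, rfl⟩
    · rintro ⟨_, ⟨h, hh, g, hg, rfl⟩, rfl⟩
      exact ⟨h, hh, g, hg, rfl⟩
  rw [himage d, himage u]
  simp only [hnil]
  exact J.closure_isNilpotent_iff _
end

section
/- Let K ⊆ GL(n, F) and set K̃ = {h − 1 : h ∈ K ∪ K^{−1}} ⊆ Mat(n, F). Then the group H = ⟨K⟩ is unipotent if and only if the (non-unital) F-subalgebra of Mat(n, F) generated by K̃ is nilpotent. -/
open Matrix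

/-- A submonoid of unipotent matrices that spans the full matrix algebra is trivial. -/
theorem Matrix.eq_one_of_isNilpotent_sub_one {k ι : Type*} [Field k] [Fintype ι] [DecidableEq ι]
    (M : Submonoid (Matrix ι ι k)) (hspan : Submodule.span k (M : Set (Matrix ι ι k)) = ⊤)
    (hM : ∀ g ∈ M, IsNilpotent (g - 1)) {g : Matrix ι ι k} (hg : g ∈ M) : g = 1 := by
  have trace_eq : ∀ h ∈ M, trace h = trace (1 : Matrix ι ι k) := fun h hh ↦ by
    have := (Matrix.isNilpotent_trace_of_isNilpotent (hM h hh)).eq_zero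
    rwa [trace_sub, sub_eq_zero] at this
  rw [← sub_eq_zero, Matrix.ext_iff_trace_mul_right]
  intro x
  have hx : x ∈ Submodule.span k (M : Set (Matrix ι ι k)) := hspan ▸ Submodule.mem_top
  induction hx using Submodule.span_induction with
  | mem y hy =>
    rw [sub_mul, trace_sub, one_mul, trace_eq _ (M.mul_mem hg hy), trace_eq _ hy]
    simp
  | zero => simp
  | add y z _ _ hy hz => simpa [mul_add] using by rw [hy, hz]; simp
  | smul c y _ hy => simp [hy]

/-- A unipotent submonoid spanning a finite-dimensional algebra over an algebraically closed field
is trivial modulo the Jacobson radical. -/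
theorem Ring.sub_one_mem_jacobson_of_isNilpotent {k A : Type*} [Field k] [IsAlgClosed k] [Ring A]
    [Algebra k A] [FiniteDimensional k A] (M : Submonoid A)
    (hspan : Submodule.span k (M : Set A) = ⊤) (hM : ∀ g ∈ M, IsNilpotent (g - 1))
    {g : A} (hg : g ∈ M) : g - 1 ∈ Ring.jacobson A := by
  have := IsArtinianRing.of_finite k A
  obtain ⟨r, d, -, ⟨e⟩⟩ :=
    IsSemisimpleRing.exists_algEquiv_pi_matrix_of_isAlgClosed k (A ⧸ Ring.jacobson A)
  let π : A →ₐ[k] A ⧸ Ring.jacobson A := Ideal.Quotient.mkₐ k _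
  have hπ : Function.Surjective π := Ideal.Quotient.mkₐ_surjective k _
  refine Ideal.Quotient.eq_zero_iff_mem.mp (?_ : π (g - 1) = 0)
  refine e.injective (funext fun i ↦ ?_)
  let f : A →ₐ[k] Matrix (Fin (d i)) (Fin (d i)) k :=
    (Pi.evalAlgHom k (fun i ↦ Matrix (Fin (d i)) (Fin (d i)) k) i).comp (e.toAlgHom.comp π)
  have hf : Function.Surjective f :=
    (Function.surjective_eval i).comp (e.surjective.comp hπ)
  have key : f g = 1 := by
    refine Matrix.eq_one_of_isNilpotent_sub_one (M.map f) ?_ ?_ (Submonoid.mem_map_of_mem f hg)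
    · have := Submodule.map_span f.toLinearMap (M : Set A)
      rw [hspan, Submodule.map_top, LinearMap.range_eq_top.mpr hf] at this
      exact this.symm
    · rintro _ ⟨h, hh, rfl⟩
      simpa using (hM h hh).map f
  change f (g - 1) = _
  simp [key]

/-- The algebra generated by the elements `g - 1`, for `g` in a unipotent monoid of matrices, is
nilpotent. -/
theorem Matrix.exists_list_prod_eq_zero_of_unipotent {F ι : Type*} [Field F] [Fintype ι] [DecidableEq ι]
    (M : Submonoid (Matrix ι ι F)) (hM : ∀ g ∈ M, IsNilpotent (g - 1)) :
    ∃ m : ℕ, ∀ l : List (Matrix ι ι F),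
      (∀ x ∈ l, x ∈ NonUnitalAlgebra.adjoin F {y | ∃ g ∈ M, y = g - 1}) →
      l.length = m → l.prod = 0 := by
  let k := AlgebraicClosure F
  let φ : Matrix ι ι F →ₐ[F] Matrix ι ι k := (Algebra.ofId F k).mapMatrix
  have hφ : Function.Injective φ := Matrix.map_injective (algebraMap F k).injective
  let S : Set (Matrix ι ι k) := M.map φ
  let A := Algebra.adjoin k S
  let N : Submonoid A := (M.map φ).comap A.val
  have hspan : Submodule.span k (N : Set A) = ⊤ := by
    have h := Algebra.adjoin_eq_span k (N : Set A)
    rw [Submonoid.closure_eq] at h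
    rw [← h]
    exact congrArg Subalgebra.toSubmodule (Algebra.adjoin_adjoin_coe_preimage (R := k) (s := S))
  have hN : ∀ g ∈ N, IsNilpotent (g - 1) := by
    rintro g ⟨h, hh, hgh⟩
    refine (IsNilpotent.map_iff (f := A.val) Subtype.val_injective).mp ?_
    rw [map_sub, map_one, ← hgh]
    have h' := (hM h hh).map φ.toRingHom
    rw [map_sub, map_one] at h'
    exact h'
  have := IsArtinianRing.of_finite k A
  have lift : ∀ x ∈ NonUnitalAlgebra.adjoin F {y | ∃ g ∈ M, y = g - 1},
      ∃ a ∈ Ring.jacobson A, (a : Matrix ι ι k) = φ x := by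
    intro x hx
    induction hx using NonUnitalAlgebra.adjoin_induction with
    | mem x hx =>
      obtain ⟨g, hg, rfl⟩ := hx
      have hgS : φ g ∈ S := ⟨g, hg, rfl⟩
      exact ⟨⟨φ g, Algebra.subset_adjoin hgS⟩ - 1,
        Ring.sub_one_mem_jacobson_of_isNilpotent N hspan hN hgS, by simp⟩
    | add x y _ _ hx hy =>
      obtain ⟨a, ha, hax⟩ := hx
      obtain ⟨b, hb, hby⟩ := hy
      exact ⟨a + b, add_mem ha hb, by simp [hax, hby]⟩
    | zero => exact ⟨0, zero_mem _, by simp⟩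
    | mul x y _ _ hx hy =>
      obtain ⟨a, -, hax⟩ := hx
      obtain ⟨b, hb, hby⟩ := hy
      exact ⟨a * b, Ideal.mul_mem_left _ a hb, by simp [hax, hby]⟩
    | smul r x _ hx =>
      obtain ⟨a, ha, hax⟩ := hx
      refine ⟨algebraMap k A (algebraMap F k r) * a, Ideal.mul_mem_left _ _ ha, ?_⟩
      rw [← Algebra.smul_def, Subalgebra.coe_smul, hax, algebraMap_smul, map_smul]
  obtain ⟨m, hm⟩ := IsSemiprimaryRing.isNilpotent (R := A)
  have lift_prod : ∀ l : List (Matrix ι ι F),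
      (∀ x ∈ l, x ∈ NonUnitalAlgebra.adjoin F {y | ∃ g ∈ M, y = g - 1}) →
      ∃ a ∈ Ring.jacobson A ^ l.length, (a : Matrix ι ι k) = φ l.prod := by
    intro l hl
    induction l with
    | nil => exact ⟨1, by simp [Submodule.pow_zero, Ideal.one_eq_top], by simp⟩
    | cons x l ih =>
      obtain ⟨b, hb, hbl⟩ := ih fun y hy ↦ hl y (List.mem_cons_of_mem _ hy)
      obtain ⟨a, ha, hax⟩ := lift x (hl x List.mem_cons_self)
      refine ⟨a * b, ?_, by simp [hax, hbl]⟩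
      rw [List.length_cons, Ideal.IsTwoSided.pow_succ]
      exact Ideal.mul_mem_mul ha hb
  refine ⟨m, fun l hl hlen ↦ hφ ?_⟩
  obtain ⟨a, ha, hal⟩ := lift_prod l hl
  rw [hlen, hm] at ha
  have ha0 : a = 0 := ha
  rw [← hal, ha0, map_zero, ZeroMemClass.coe_zero]

theorem Matrix.pow_card_eq_zero_of_isNilpotent {F ι : Type*} [Field F] [Fintype ι] [DecidableEq ι]
    {x : Matrix ι ι F} (hx : IsNilpotent x) : x ^ Fintype.card ι = 0 := by
  have h := (Matrix.isNilpotent_charpoly_sub_pow_of_isNilpotent hx).eq_zero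
  have hc := x.aeval_self_charpoly
  rwa [sub_eq_zero.mp h, map_pow, Polynomial.aeval_X] at hc

theorem Matrix.sub_one_mem_adjoin_of_mem_closure {F ι : Type*} [Field F] [Fintype ι]
    [DecidableEq ι] (K : Set (GL ι F)) {h : GL ι F} (hh : h ∈ Subgroup.closure K) :
    (h : Matrix ι ι F) - 1 ∈ NonUnitalAlgebra.adjoin F
      {y : Matrix ι ι F | ∃ g ∈ K ∪ K⁻¹, y = (g : Matrix ι ι F) - 1} := by
  induction hh using Subgroup.closure_induction'' with
  | mem x hx => exact NonUnitalAlgebra.subset_adjoin F ⟨x, Or.inl hx, rfl⟩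
  | inv_mem x hx => exact NonUnitalAlgebra.subset_adjoin F ⟨x⁻¹, Or.inr (by simpa using hx), rfl⟩
  | one => simp
  | mul x y _ _ hx hy =>
    have : ((x * y : GL ι F) : Matrix ι ι F) - 1 = (x.val - 1) * (y.val - 1) + (x.val - 1)
        + (y.val - 1) := by
      rw [Units.val_mul]; noncomm_ring
    rw [this]
    exact add_mem (add_mem (mul_mem hx hy) hx) hy

/-- `⟨K⟩` is unipotent iff the non-unital `F`-algebra generated by
`{h - 1 : h ∈ K ∪ K⁻¹}` is nilpotent. -/
theorem stmt11 {n : ℕ} {F : Type*} [Field F] (K : Set (GL (Fin n) F)) :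
    (∀ h ∈ Subgroup.closure K, ((h : Matrix (Fin n) (Fin n) F) - 1) ^ n = 0) ↔
    (∃ m : ℕ, ∀ l : List (Matrix (Fin n) (Fin n) F),
      (∀ x ∈ l, x ∈ NonUnitalAlgebra.adjoin F
        {y : Matrix (Fin n) (Fin n) F | ∃ h ∈ K ∪ K⁻¹, y = (h : Matrix (Fin n) (Fin n) F) - 1}) →
      l.length = m → l.prod = 0) := by
  constructor
  · intro H
    obtain ⟨m, hm⟩ := Matrix.exists_list_prod_eq_zero_of_unipotent
      ((Subgroup.closure K).toSubmonoid.map (Units.coeHom (Matrix (Fin n) (Fin n) F)))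
      (by rintro _ ⟨h, hh, rfl⟩; exact ⟨n, H h hh⟩)
    refine ⟨m, fun l hl ↦ hm l fun x hx ↦ NonUnitalAlgebra.adjoin_mono ?_ (hl x hx)⟩
    rintro _ ⟨h, hh, rfl⟩
    refine ⟨h, ⟨h, ?_, rfl⟩, rfl⟩
    exact hh.elim (fun h ↦ Subgroup.subset_closure h) (fun h ↦ Subgroup.inv_subset_closure K h)
  · rintro ⟨m, hm⟩ h hh
    have hnil : IsNilpotent ((h : Matrix (Fin n) (Fin n) F) - 1) := by
      refine ⟨m, ?_⟩
      rw [← List.prod_replicate]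
      refine hm _ (fun x hx ↦ ?_) List.length_replicate
      rw [List.eq_of_mem_replicate hx]
      exact Matrix.sub_one_mem_adjoin_of_mem_closure K hh
    simpa using Matrix.pow_card_eq_zero_of_isNilpotent hnil
end

section
/- Let Δ be an integral domain of characteristic p > n (prime), and let G ≤ GL(n, Δ) be solvable-by-finite. Then for any proper ideal ρ of Δ, the commutator subgroup of the congruence subgroup G_ρ = ker(G → GL(n, Δ/ρ)) is unipotent. -/
open Matrix

section LinearActions

open scoped commutatorElement

variable {F V ι : Type*} [Field F] [AddCommGroup V] [Module F V]

theorem linearIndependent_of_simultaneous_eigenvectors {f : ι → Module.End F V}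
    (hf : ∀ i j, Commute (f i) (f j)) {κ : Type*} {χ : κ → ι → F} (hχ : Function.Injective χ)
    {v : κ → V} (hv : ∀ k, v k ≠ 0) (hfv : ∀ k i, f i (v k) = χ k i • v k) :
    LinearIndependent F v := by
  have h := Module.End.independent_iInf_maxGenEigenspace_of_forall_mapsTo f
    (fun i j φ => Module.End.mapsTo_maxGenEigenspace_of_comm (hf j i) φ)
  refine (h.comp hχ).linearIndependent _ (fun k => ?_) hv
  rw [Function.comp_apply, Module.End.mem_iInf_maxGenEigenspace_iff]
  exact fun j => ⟨1, by simp [hfv]⟩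

theorem exists_simultaneous_eigenvector [IsAlgClosed F] [FiniteDimensional F V] [Nontrivial V]
    {f : ι → Module.End F V} (hf : ∀ i j, Commute (f i) (f j)) :
    ∃ (χ : ι → F) (v : V), v ≠ 0 ∧ ∀ i, f i v = χ i • v := by
  obtain ⟨W, ⟨hW0, hW⟩, hmin⟩ := WellFounded.has_min (wellFounded_lt (α := Submodule F V))
    {W | W ≠ ⊥ ∧ ∀ i, ∀ w ∈ W, f i w ∈ W} ⟨⊤, top_ne_bot, by simp⟩
  have key (i : ι) : ∃ c : F, ∀ w ∈ W, f i w = c • w := by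
    have : Nontrivial W := Submodule.nontrivial_iff_ne_bot.mpr hW0
    obtain ⟨c, hc⟩ := Module.End.exists_eigenvalue ((f i).restrict (hW i))
    obtain ⟨w, hw⟩ := hc.exists_hasEigenvector
    have hw' : f i w = c • (w : V) := congrArg Subtype.val hw.apply_eq_smul
    let U := W ⊓ (f i).eigenspace c
    have hU : U = W := by
      by_contra hne
      refine hmin U ⟨?_, fun j u hu => ⟨hW j u hu.1, ?_⟩⟩ (lt_of_le_of_ne inf_le_left hne)
      · refine (Submodule.ne_bot_iff _).mpr ⟨w, ⟨w.2, ?_⟩, ?_⟩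
        · exact Module.End.mem_eigenspace_iff.mpr hw'
        · simpa using hw.2
      · have hu2 := Module.End.mem_eigenspace_iff.mp hu.2
        refine Module.End.mem_eigenspace_iff.mpr ?_
        have := LinearMap.congr_fun (hf i j).eq u
        simp only [Module.End.mul_apply] at this
        rw [this, hu2, map_smul]
    refine ⟨c, fun w hw => ?_⟩
    rw [← hU] at hw
    exact Module.End.mem_eigenspace_iff.mp hw.2
  choose χ hχ using key
  obtain ⟨w, hw, hw0⟩ := (Submodule.ne_bot_iff _).mp hW0
  exact ⟨χ, w, hw0, fun i => hχ i w hw⟩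

/-- No ratio of distinct eigenvalues of an operator `ρ h` is a root of unity. -/
def HasNetSpectrum {H : Type*} [Group H] (ρ : H →* Module.End F V) : Prop :=
  ∀ h μ ν k, 0 < k → (ρ h).HasEigenvalue μ → (ρ h).HasEigenvalue ν → μ ^ k = ν ^ k → μ = ν

/-- The only invariant subspaces are `⊥` and `⊤`. -/
def HasTrivialInvariants {H : Type*} [Group H] (ρ : H →* Module.End F V) : Prop :=
  ∀ W : Submodule F V, (∀ h, ∀ w ∈ W, ρ h w ∈ W) → W = ⊥ ∨ W = ⊤

/-- The normal subgroup of elements acting as scalars. -/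
def scalarSubgroup {H : Type*} [Group H] (ρ : H →* Module.End F V) : Subgroup H where
  carrier := {h | ∃ c : F, ρ h = c • 1}
  one_mem' := ⟨1, by simp⟩
  mul_mem' := by
    rintro a b ⟨c, hc⟩ ⟨d, hd⟩
    exact ⟨c * d, by rw [map_mul, hc, hd, smul_mul_smul_comm, mul_one]⟩
  inv_mem' := by
    rintro a ⟨c, hc⟩
    have h1 : c • ρ a⁻¹ = 1 := by
      have : ρ a * ρ a⁻¹ = 1 := by rw [← map_mul, mul_inv_cancel, map_one]
      rwa [hc, smul_one_mul] at this
    by_cases h0 : c = 0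
    · rw [h0, zero_smul] at h1
      exact ⟨0, by rw [← mul_one (ρ a⁻¹), ← h1, mul_zero, smul_zero]⟩
    · exact ⟨c⁻¹, by rw [← h1, smul_smul, inv_mul_cancel₀ h0, one_smul]⟩

variable {H : Type*} [Group H] {ρ : H →* Module.End F V}

instance scalarSubgroup_normal : (scalarSubgroup ρ).Normal := by
  refine ⟨fun a ⟨c, hc⟩ g => ⟨c, ?_⟩⟩
  rw [map_mul, map_mul, hc, mul_smul_one, smul_mul_assoc, ← map_mul, mul_inv_cancel, map_one]

theorem apply_inv_apply_self (h : H) (v : V) : ρ h⁻¹ (ρ h v) = v := by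
  rw [← Module.End.mul_apply, ← map_mul, inv_mul_cancel, map_one, Module.End.one_apply]

theorem apply_ne_zero (h : H) {v : V} (hv : v ≠ 0) : ρ h v ≠ 0 := fun h0 =>
  hv (by rw [← apply_inv_apply_self (ρ := ρ) h v, h0, map_zero])

theorem hasEigenvalue_of_pow_apply_eq {f : Module.End F V} {w : V} {μ : F} {k : ℕ} (hk : 0 < k)
    (hw : (f ^ k) w = μ • w) (hind : LinearIndependent F fun i : Fin k => (f ^ (i : ℕ)) w)
    {ν : F} (hν : ν ^ k = μ) : f.HasEigenvalue ν := by
  let u := ∑ i : Fin k, ν ^ (k - 1 - i) • (f ^ (i : ℕ)) w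
  have hu0 : u ≠ 0 := fun h0 => by
    have := Fintype.linearIndependent_iff.mp hind _ h0 ⟨k - 1, by omega⟩
    simp at this
  refine Module.End.hasEigenvalue_of_hasEigenvector (x := u)
    ⟨Module.End.mem_eigenspace_iff.mpr ?_, hu0⟩
  have hc : Commute f (algebraMap F (Module.End F V) ν) := (Algebra.commutes ν f).symm
  have h := LinearMap.congr_fun (hc.mul_geom_sum₂ k) w
  have hu : (∑ i ∈ Finset.range k,
      f ^ i * algebraMap F (Module.End F V) ν ^ (k - 1 - i)) w = u := by
    rw [Finset.sum_range, LinearMap.sum_apply]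
    refine Finset.sum_congr rfl fun i _ => ?_
    rw [← map_pow, ← Algebra.commutes, Module.End.mul_apply, Module.algebraMap_end_apply]
  rw [Module.End.mul_apply, hu, LinearMap.sub_apply, LinearMap.sub_apply, hw, ← map_pow,
    Module.algebraMap_end_apply, Module.algebraMap_end_apply, hν, sub_self] at h
  exact sub_eq_zero.mp h

variable [IsAlgClosed F] [FiniteDimensional F V]

/-- The weights of a normal subgroup acting through commuting operators are fixed by conjugation. -/
theorem weight_conj_eq (p : ℕ) [Fact p.Prime] [CharP F p] (hp : Module.finrank F V < p)
    (hT : HasNetSpectrum ρ) {A : Subgroup H} [A.Normal]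
    (hA : ∀ a b : A, Commute (ρ a) (ρ b)) {χ : A → F} {v : V} (hv : v ≠ 0)
    (hχ : ∀ a : A, ρ a v = χ a • v) (h : H) (a : A) :
    χ (MulAut.conjNormal h⁻¹ a) = χ a := by
  let ψ : ℕ → A → F := fun i b => χ (MulAut.conjNormal (h ^ i)⁻¹ b)
  have hweight (i : ℕ) (w : V) (hw : ∀ b : A, ρ b w = χ b • w) (b : A) :
      ρ b (ρ (h ^ i) w) = ψ i b • ρ (h ^ i) w := by
    have hb : (b : H) * h ^ i = h ^ i * (MulAut.conjNormal (h ^ i)⁻¹ b : A) := by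
      rw [MulAut.conjNormal_apply]; group
    rw [← Module.End.mul_apply, ← map_mul, hb, map_mul, Module.End.mul_apply, hw, map_smul]
  have hshift {i j : ℕ} (hij : i ≤ j) (he : ψ i = ψ j) : ψ (j - i) = χ := by
    funext b
    have := congrFun he (MulAut.conjNormal (h ^ i) b)
    simp only [ψ, ← MulAut.mul_apply, ← map_mul, inv_mul_cancel, map_one,
      MulAut.one_apply] at this
    rw [this]
    simp only [ψ]
    congr 3
    nth_rewrite 2 [← Nat.sub_add_cancel hij]
    rw [add_comm, pow_add]
    group
  have hindep {k : ℕ} (hk : Function.Injective fun i : Fin k => ψ i) {w : V} (hw0 : w ≠ 0)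
      (hw : ∀ b : A, ρ b w = χ b • w) :
      LinearIndependent F fun i : Fin k => (ρ h ^ (i : ℕ)) w :=
    linearIndependent_of_simultaneous_eigenvectors (f := fun b : A => ρ b) hA hk
      (fun i => by rw [← map_pow]; exact apply_ne_zero _ hw0)
      (fun i b => by rw [← map_pow]; exact hweight i w hw b)
  have hex : ∃ k, 0 < k ∧ k ≤ Module.finrank F V ∧ ψ k = χ := by
    by_contra! hne
    have hinj : Function.Injective fun i : Fin (Module.finrank F V + 1) => ψ i := by
      intro i j he
      by_contra hij
      rcases lt_or_gt_of_ne (Fin.val_ne_of_ne hij) with hlt | hlt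
      · exact hne _ (by omega) (by omega) (hshift hlt.le he)
      · exact hne _ (by omega) (by omega) (hshift hlt.le he.symm)
    have := (hindep hinj hv hχ).fintype_card_le_finrank
    simp at this
  classical
  obtain ⟨hk0, hkd, hkψ⟩ := Nat.find_spec hex
  have hkmin := fun m => Nat.find_min (m := m) hex
  set k := Nat.find hex
  have hinj : Function.Injective fun i : Fin k => ψ i := by
    intro i j he
    by_contra hij
    rcases lt_or_gt_of_ne (Fin.val_ne_of_ne hij) with hlt | hlt
    · exact hkmin _ (by omega) ⟨by omega, by omega, hshift hlt.le he⟩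
    · exact hkmin _ (by omega) ⟨by omega, by omega, hshift hlt.le he.symm⟩
  let W : Submodule F V := ⨅ b : A, (ρ b).eigenspace (χ b)
  have hW {w : V} : w ∈ W ↔ ∀ b : A, ρ b w = χ b • w := by
    simp [W, Submodule.mem_iInf]
  have hWk : ∀ w ∈ W, ρ (h ^ k) w ∈ W := fun w hw =>
    hW.mpr fun b => by rw [hweight k w (hW.mp hw), hkψ]
  have : Nontrivial W := Submodule.nontrivial_iff_ne_bot.mpr
    ((Submodule.ne_bot_iff _).mpr ⟨v, hW.mpr hχ, hv⟩)
  obtain ⟨μ, hμ⟩ := Module.End.exists_eigenvalue ((ρ (h ^ k)).restrict hWk)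
  obtain ⟨w, hw⟩ := hμ.exists_hasEigenvector
  have hw0 : (w : V) ≠ 0 := by simpa using hw.2
  have hwμ : ρ (h ^ k) w = μ • (w : V) := congrArg Subtype.val hw.apply_eq_smul
  have hμ0 : μ ≠ 0 := fun h0 => apply_ne_zero (ρ := ρ) (h ^ k) hw0 (by rw [hwμ, h0, zero_smul])
  have heig {ν : F} (hν : ν ^ k = μ) : (ρ h).HasEigenvalue ν :=
    hasEigenvalue_of_pow_apply_eq hk0 (by rw [← map_pow, hwμ]) (hindep hinj hw0 (hW.mp w.2)) hν
  have hk1 : k = 1 := by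
    by_contra hne
    have : NeZero (k : F) := ⟨fun h0 => by
      have := Nat.le_of_dvd hk0 ((CharP.cast_eq_zero_iff F p k).mp h0)
      omega⟩
    obtain ⟨ζ, hζ⟩ := HasEnoughRootsOfUnity.exists_primitiveRoot F k
    obtain ⟨ν, hν⟩ := IsAlgClosed.exists_pow_nat_eq μ hk0
    have hζν : (ζ * ν) ^ k = μ := by rw [mul_pow, hζ.pow_eq_one, one_mul, hν]
    have := hT h _ _ k hk0 (heig hζν) (heig hν) (by rw [hν, hζν])
    have hν0 : ν ≠ 0 := fun h0 => hμ0 (by rw [← hν, h0, zero_pow hk0.ne'])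
    exact hζ.ne_one (by omega) (mul_right_cancel₀ hν0 (by rw [this, one_mul]))
  have := congrFun hkψ a
  rwa [hk1, show ψ 1 a = χ (MulAut.conjNormal h⁻¹ a) by simp [ψ]] at this

theorem le_scalarSubgroup_of_commute [Nontrivial V] (p : ℕ) [Fact p.Prime] [CharP F p]
    (hp : Module.finrank F V < p) (hT : HasNetSpectrum ρ) (hI : HasTrivialInvariants ρ)
    {A : Subgroup H} [A.Normal] (hA : ∀ a b : A, Commute (ρ a) (ρ b)) :
    A ≤ scalarSubgroup ρ := by
  obtain ⟨χ, v, hv, hχ⟩ := exists_simultaneous_eigenvector (f := fun a : A => ρ a) hA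
  let W : Submodule F V := ⨅ b : A, (ρ b).eigenspace (χ b)
  have hW {w : V} : w ∈ W ↔ ∀ b : A, ρ b w = χ b • w := by
    simp [W, Submodule.mem_iInf]
  have hWtop : W = ⊤ := by
    refine (hI W fun h w hw => hW.mpr fun b => ?_).resolve_left
      ((Submodule.ne_bot_iff _).mpr ⟨v, hW.mpr hχ, hv⟩)
    have hb : (b : H) * h = h * (MulAut.conjNormal h⁻¹ b : A) := by
      rw [MulAut.conjNormal_apply]; group
    rw [← Module.End.mul_apply, ← map_mul, hb, map_mul, Module.End.mul_apply, hW.mp hw, map_smul,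
      weight_conj_eq p hp hT hA hv hχ]
  intro a ha
  exact ⟨χ ⟨a, ha⟩, LinearMap.ext fun w => hW.mp (hWtop ▸ Submodule.mem_top) ⟨a, ha⟩⟩

theorem commute_of_commutator_mem_scalarSubgroup [Nontrivial V] (hT : HasNetSpectrum ρ) {a b : H}
    (hab : ⁅a, b⁆ ∈ scalarSubgroup ρ) : Commute (ρ a) (ρ b) := by
  obtain ⟨c, hc⟩ := hab
  have hmul : ρ a * ρ b = c • (ρ b * ρ a) := by
    rw [← map_mul, ← map_mul, show a * b = ⁅a, b⁆ * (b * a) by simp [commutatorElement_def],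
      map_mul, hc, smul_one_mul]
  have hdet (h : H) : LinearMap.det (ρ h) ≠ 0 := fun h0 => by
    have : LinearMap.det (ρ h) * LinearMap.det (ρ h⁻¹) = 1 := by
      rw [← map_mul, ← map_mul, mul_inv_cancel, map_one, map_one]
    rw [h0, zero_mul] at this
    exact zero_ne_one this
  have hcd : c ^ Module.finrank F V = 1 := by
    have := congrArg LinearMap.det hmul
    rw [LinearMap.det_smul, map_mul, map_mul, mul_comm (LinearMap.det (ρ b))] at this
    exact mul_right_cancel₀ (mul_ne_zero (hdet a) (hdet b)) (by rw [one_mul, ← this])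
  obtain ⟨μ, hμ⟩ := Module.End.exists_eigenvalue (ρ a)
  obtain ⟨v, hv⟩ := hμ.exists_hasEigenvector
  have hμ0 : μ ≠ 0 := fun h0 =>
    apply_ne_zero (ρ := ρ) a hv.2 (by rw [hv.apply_eq_smul, h0, zero_smul])
  have hcμ : (ρ a).HasEigenvalue (c * μ) := by
    refine Module.End.hasEigenvalue_of_hasEigenvector (x := ρ b v)
      ⟨Module.End.mem_eigenspace_iff.mpr ?_, apply_ne_zero b hv.2⟩
    rw [← Module.End.mul_apply, hmul, LinearMap.smul_apply, Module.End.mul_apply,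
      hv.apply_eq_smul, map_smul, smul_smul]
  have := hT a _ _ _ Module.finrank_pos hcμ hμ (by rw [mul_pow, hcd, one_mul])
  rw [mul_right_cancel₀ hμ0 (this.trans (one_mul μ).symm), one_smul] at hmul
  exact hmul

theorem le_scalarSubgroup_of_iterate_commutator_le [Nontrivial V] (p : ℕ) [Fact p.Prime]
    [CharP F p] (hp : Module.finrank F V < p) (hT : HasNetSpectrum ρ)
    (hI : HasTrivialInvariants ρ) (m : ℕ) (N : Subgroup H) [N.Normal]
    (hN : (fun K : Subgroup H => ⁅K, K⁆)^[m] N ≤ scalarSubgroup ρ) : N ≤ scalarSubgroup ρ := by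
  induction m generalizing N with
  | zero => exact hN
  | succ m ih =>
    have h := ih ⁅N, N⁆ hN
    exact le_scalarSubgroup_of_commute p hp hT hI fun a b =>
      commute_of_commutator_mem_scalarSubgroup hT (h (Subgroup.commutator_mem_commutator a.2 b.2))

theorem map_derivedSeries_subtype {H : Type*} [Group H] (N : Subgroup H) (m : ℕ) :
    (derivedSeries N m).map N.subtype = (fun K : Subgroup H => ⁅K, K⁆)^[m] N := by
  induction m with
  | zero => simp [← MonoidHom.range_eq_map]
  | succ m ih => rw [derivedSeries_succ, Subgroup.map_commutator, ih, Function.iterate_succ_apply']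

theorem derivedSeries_eq_iterate (H : Type*) [Group H] (m : ℕ) :
    derivedSeries H m = (fun K : Subgroup H => ⁅K, K⁆)^[m] ⊤ := by
  induction m with
  | zero => simp
  | succ m ih => rw [derivedSeries_succ, ih, Function.iterate_succ_apply']

theorem exists_pow_char_pow_mem_scalarSubgroup (p : ℕ) [Fact p.Prime] [CharP F p]
    [Nontrivial V] (hT : HasNetSpectrum ρ) {h : H} {k : ℕ} (hk : 0 < k)
    (hh : h ^ k ∈ scalarSubgroup ρ) : ∃ a : ℕ, h ^ p ^ a ∈ scalarSubgroup ρ := by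
  obtain ⟨c, hc⟩ := hh
  have hpow {ν : F} (hν : (ρ h).HasEigenvalue ν) : ν ^ k = c := by
    obtain ⟨v, hv⟩ := hν.exists_hasEigenvector
    have h1 := hv.pow_apply k
    rw [← map_pow, hc, LinearMap.smul_apply, Module.End.one_apply] at h1
    exact (smul_left_injective F hv.2 h1).symm
  obtain ⟨μ, hμ⟩ := Module.End.exists_eigenvalue (ρ h)
  have htop : (ρ h).maxGenEigenspace μ = ⊤ := by
    rw [eq_top_iff, ← Module.End.iSup_maxGenEigenspace_eq_top (ρ h)]
    refine iSup_le fun ν => ?_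
    by_cases hν : (ρ h).HasEigenvalue ν
    · rw [hT h ν μ k hk hν hμ (by rw [hpow hν, hpow hμ])]
    · have : (ρ h).maxGenEigenspace ν = ⊥ := by
        by_contra hne
        rw [Module.End.maxGenEigenspace_eq_genEigenspace_finrank] at hne
        exact hν ((Module.End.hasGenEigenvalue_iff_hasEigenvalue Module.finrank_pos).mp hne)
      rw [this]; exact bot_le
  have hnil : ∀ v, ((ρ h - algebraMap F _ μ) ^ Module.finrank F V) v = 0 := fun v => by
    have hv : v ∈ (ρ h).maxGenEigenspace μ := htop ▸ Submodule.mem_top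
    rw [Module.End.maxGenEigenspace_eq_genEigenspace_finrank,
      Module.End.mem_genEigenspace_nat, LinearMap.mem_ker] at hv
    rwa [Algebra.algebraMap_eq_smul_one]
  refine ⟨Module.finrank F V, μ ^ p ^ Module.finrank F V, ?_⟩
  have : CharP (Module.End F V) p := charP_of_injective_algebraMap' F p
  have hle : Module.finrank F V ≤ p ^ Module.finrank F V :=
    (Nat.lt_pow_self (Fact.out : p.Prime).one_lt).le
  have h0 : (ρ h - algebraMap F _ μ) ^ p ^ Module.finrank F V = 0 :=
    pow_eq_zero_of_le hle (LinearMap.ext hnil)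
  rw [sub_pow_char_pow_of_commute p _ (Algebra.commutes μ (ρ h)).symm, sub_eq_zero, ← map_pow,
    ← map_pow, Algebra.algebraMap_eq_smul_one] at h0
  exact h0

theorem scalarSubgroup_eq_top [Nontrivial V] (p : ℕ) [Fact p.Prime] [CharP F p]
    (hp : Module.finrank F V < p) (hT : HasNetSpectrum ρ) (hI : HasTrivialInvariants ρ)
    (N : Subgroup H) [N.Normal] [N.FiniteIndex] [Group.IsSolvable N] :
    scalarSubgroup ρ = ⊤ := by
  have hN : N ≤ scalarSubgroup ρ := by
    obtain ⟨m, hm⟩ := (Group.isSolvable_def N).mp inferInstance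
    refine le_scalarSubgroup_of_iterate_commutator_le p hp hT hI m N ?_
    rw [← map_derivedSeries_subtype, hm, Subgroup.map_bot]
    exact bot_le
  have : (scalarSubgroup ρ).FiniteIndex := Subgroup.finiteIndex_of_le hN
  have hpg : IsPGroup p (H ⧸ scalarSubgroup ρ) := by
    intro q
    obtain ⟨h, rfl⟩ := QuotientGroup.mk_surjective q
    obtain ⟨a, ha⟩ := exists_pow_char_pow_mem_scalarSubgroup p hT
      (Nat.pos_of_ne_zero Subgroup.FiniteIndex.index_ne_zero)
      (Subgroup.pow_index_mem (scalarSubgroup ρ) h)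
    exact ⟨a, by rwa [← QuotientGroup.mk_pow, QuotientGroup.eq_one_iff]⟩
  have := hpg.isNilpotent
  obtain ⟨m, hm⟩ := (Group.isSolvable_def (H ⧸ scalarSubgroup ρ)).mp inferInstance
  rw [eq_top_iff]
  refine le_scalarSubgroup_of_iterate_commutator_le p hp hT hI m ⊤ ?_
  rw [← derivedSeries_eq_iterate]
  rw [← map_derivedSeries_eq (QuotientGroup.mk'_surjective (scalarSubgroup ρ)),
    Subgroup.map_eq_bot_iff, QuotientGroup.ker_mk'] at hm
  exact hm

end LinearActions

section UnipotentCommutator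

open scoped commutatorElement

variable {F V H : Type*} [Field F] [AddCommGroup V] [Module F V] [Group H]
  {ρ : H →* Module.End F V}

/-- The restriction of a linear action to an invariant subspace. -/
def restrictHom (ρ : H →* Module.End F V) (W : Submodule F V)
    (hW : ∀ h, ∀ w ∈ W, ρ h w ∈ W) : H →* Module.End F W where
  toFun h := (ρ h).restrict (hW h)
  map_one' := by ext; simp
  map_mul' a b := by ext; simp

/-- The action induced by a linear action on the quotient by an invariant subspace. -/
def quotientHom (ρ : H →* Module.End F V) (W : Submodule F V)
    (hW : ∀ h, ∀ w ∈ W, ρ h w ∈ W) : H →* Module.End F (V ⧸ W) where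
  toFun h := W.mapQ W (ρ h) (hW h)
  map_one' := by ext; simp
  map_mul' a b := by ext; simp

theorem HasNetSpectrum.restrictHom (hT : HasNetSpectrum ρ) {W : Submodule F V}
    (hW : ∀ h, ∀ w ∈ W, ρ h w ∈ W) : HasNetSpectrum (restrictHom ρ W hW) := by
  have key {h : H} {μ : F} (hμ : (_root_.restrictHom ρ W hW h).HasEigenvalue μ) :
      (ρ h).HasEigenvalue μ := by
    obtain ⟨w, hw⟩ := hμ.exists_hasEigenvector
    exact Module.End.hasEigenvalue_of_hasEigenvector (x := (w : V))
      ⟨Module.End.mem_eigenspace_iff.mpr (congrArg Subtype.val hw.apply_eq_smul),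
        by simpa using hw.2⟩
  exact fun h μ ν k hk hμ hν => hT h μ ν k hk (key hμ) (key hν)

theorem HasNetSpectrum.quotientHom [FiniteDimensional F V] (hT : HasNetSpectrum ρ)
    {W : Submodule F V} (hW : ∀ h, ∀ w ∈ W, ρ h w ∈ W) :
    HasNetSpectrum (quotientHom ρ W hW) := by
  have key {h : H} {μ : F} (hμ : (_root_.quotientHom ρ W hW h).HasEigenvalue μ) :
      (ρ h).HasEigenvalue μ := by
    obtain ⟨q, hq⟩ := hμ.exists_hasEigenvector
    obtain ⟨v, rfl⟩ := W.mkQ_surjective q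
    by_contra hne
    let g : Module.End F V := ρ h - algebraMap F _ μ
    have hg : Function.Injective g := by
      rw [← LinearMap.ker_eq_bot]
      refine (Submodule.eq_bot_iff _).mpr fun u hu => ?_
      by_contra hu0
      refine hne (Module.End.hasEigenvalue_of_hasEigenvector (x := u)
        ⟨Module.End.mem_eigenspace_iff.mpr ?_, hu0⟩)
      simpa [g, sub_eq_zero] using hu
    have hgW : ∀ w ∈ W, g w ∈ W := fun w hw => by
      simpa [g] using W.sub_mem (hW h w hw) (W.smul_mem μ hw)
    have hsurj : Function.Surjective (g.restrict hgW) := by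
      rw [← LinearMap.injective_iff_surjective]
      intro a b hab
      exact Subtype.ext (hg (congrArg Subtype.val hab))
    have hgv : g v ∈ W := by
      have h1 : W.mkQ (ρ h v) = μ • W.mkQ v := hq.apply_eq_smul
      rw [← map_smul, ← sub_eq_zero, ← map_sub, Submodule.mkQ_apply,
        Submodule.Quotient.mk_eq_zero] at h1
      simpa [g] using h1
    obtain ⟨w, hw⟩ := hsurj ⟨g v, hgv⟩
    have hwv : (w : V) = v := hg (congrArg Subtype.val hw)
    exact hq.2 (by rw [Submodule.mkQ_apply, Submodule.Quotient.mk_eq_zero, ← hwv]; exact w.2)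
  exact fun h μ ν k hk hμ hν => hT h μ ν k hk (key hμ) (key hν)

theorem isNilpotent_sub_one_of_restrict_of_quotient {W : Submodule F V}
    (hW : ∀ h, ∀ w ∈ W, ρ h w ∈ W) {x : H} (h1 : IsNilpotent (restrictHom ρ W hW x - 1))
    (h2 : IsNilpotent (quotientHom ρ W hW x - 1)) : IsNilpotent (ρ x - 1) := by
  obtain ⟨a, ha⟩ := h1
  obtain ⟨b, hb⟩ := h2
  have hsub (m : ℕ) (w : W) :
      (((restrictHom ρ W hW x - 1) ^ m) w : V) = ((ρ x - 1) ^ m) (w : V) := by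
    induction m with
    | zero => rfl
    | succ m ih =>
      rw [pow_succ', pow_succ', Module.End.mul_apply, Module.End.mul_apply, ← ih]
      rfl
  have hquo (m : ℕ) (v : V) :
      ((quotientHom ρ W hW x - 1) ^ m) (W.mkQ v) = W.mkQ (((ρ x - 1) ^ m) v) := by
    induction m with
    | zero => rfl
    | succ m ih =>
      rw [pow_succ', pow_succ', Module.End.mul_apply, Module.End.mul_apply, ih]
      rfl
  refine ⟨a + b, LinearMap.ext fun v => ?_⟩
  have hmem : ((ρ x - 1) ^ b) v ∈ W := by
    rw [← Submodule.Quotient.mk_eq_zero, ← Submodule.mkQ_apply, ← hquo, hb, LinearMap.zero_apply]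
  rw [pow_add, Module.End.mul_apply, ← hsub a ⟨_, hmem⟩, ha]
  rfl

theorem map_eq_one_of_mem_commutator (hρ : scalarSubgroup ρ = ⊤) {x : H}
    (hx : x ∈ commutator H) : ρ x = 1 := by
  suffices h : commutator H ≤ ρ.ker from h hx
  rw [commutator_def, Subgroup.commutator_le]
  intro a _ b _
  obtain ⟨c, hc⟩ : a ∈ scalarSubgroup ρ := hρ ▸ Subgroup.mem_top a
  have hab : ρ (a * b) = ρ (b * a) := by rw [map_mul, map_mul, hc, smul_one_mul, mul_smul_one]
  rw [MonoidHom.mem_ker, commutatorElement_def, mul_assoc, map_mul, hab, ← map_mul]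
  simp

theorem isNilpotent_sub_one_of_mem_commutator [IsAlgClosed F] (p : ℕ) [Fact p.Prime] [CharP F p]
    (N : Subgroup H) [N.Normal] [N.FiniteIndex] [Group.IsSolvable N] {x : H}
    (hx : x ∈ commutator H) {V : Type*} [AddCommGroup V] [Module F V] [FiniteDimensional F V]
    (hp : Module.finrank F V < p) {ρ : H →* Module.End F V} (hT : HasNetSpectrum ρ) :
    IsNilpotent (ρ x - 1) := by
  induction hd : Module.finrank F V using Nat.strong_induction_on generalizing V with
  | _ d ih =>
  rcases subsingleton_or_nontrivial V with hV | hV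
  · exact ⟨1, Subsingleton.elim _ _⟩
  by_cases hI : HasTrivialInvariants ρ
  · rw [map_eq_one_of_mem_commutator (scalarSubgroup_eq_top p hp hT hI N) hx, sub_self]
    exact IsNilpotent.zero
  · simp only [HasTrivialInvariants, not_forall, not_or] at hI
    obtain ⟨W, hW, hbot, htop⟩ := hI
    have hlt : Module.finrank F W < Module.finrank F V := Submodule.finrank_lt htop
    have hpos : 0 < Module.finrank F W := by
      have := Submodule.nontrivial_iff_ne_bot.mpr hbot
      exact Module.finrank_pos
    have hadd := W.finrank_quotient_add_finrank
    exact isNilpotent_sub_one_of_restrict_of_quotient hW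
      (ih _ (by omega) (by omega) (hT.restrictHom hW) rfl)
      (ih _ (by omega) (by omega) (hT.quotientHom hW) rfl)

end UnipotentCommutator

theorem eq_of_pow_eq_pow_of_map_eq_one {S K : Type*} [CommRing S] [IsDomain S] [Field K] (p : ℕ)
    [Fact p.Prime] [CharP S p] (r : S →+* K) {μ ν : S} (hμ : r μ = 1) (hν : r ν = 1) {k : ℕ}
    (hk : 0 < k) (h : μ ^ k = ν ^ k) : μ = ν := by
  obtain ⟨a, m, hm, rfl⟩ := Nat.exists_eq_pow_mul_and_not_dvd hk.ne' p
    (Fact.out : p.Prime).ne_one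
  have hK : CharP K p := by
    have : r p = 0 := by rw [CharP.cast_eq_zero, map_zero]
    rw [map_natCast] at this
    exact (CharP.charP_iff_prime_eq_zero Fact.out).mpr this
  have h1 : μ ^ m = ν ^ m := by
    rw [mul_comm, pow_mul, pow_mul] at h
    exact iterateFrobenius_inj S p a (by simpa [iterateFrobenius_def] using h)
  have h2 := (Commute.all μ ν).mul_geom_sum₂ m
  rw [h1, sub_self, mul_eq_zero] at h2
  refine sub_eq_zero.mp (h2.resolve_right fun h0 => hm ?_)
  have h3 := congrArg r h0
  simp only [map_sum, map_mul, map_pow, hμ, hν, one_pow, mul_one, Finset.sum_const,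
    Finset.card_range, nsmul_eq_mul, map_zero] at h3
  exact (CharP.cast_eq_zero_iff K p m).mp h3

theorem exists_residue_eq_one_of_hasEigenvalue {n : ℕ} {Δ F K : Type*} [CommRing Δ] [Field F]
    [Algebra Δ F] [Field K] (r : integralClosure Δ F →+* K) {g : Matrix (Fin n) (Fin n) Δ}
    (hg : g.map (r.comp (algebraMap Δ (integralClosure Δ F))) = 1) {μ : F}
    (hμ : Module.End.HasEigenvalue (Matrix.toLin' (g.map (algebraMap Δ F))) μ) :
    ∃ s : integralClosure Δ F, (s : F) = μ ∧ r s = 1 := by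
  rw [Module.End.hasEigenvalue_iff_isRoot_charpoly, Matrix.charpoly_toLin', Matrix.charpoly_map,
    Polynomial.IsRoot.def, Polynomial.eval_map] at hμ
  let s : integralClosure Δ F := ⟨μ, g.charpoly, g.charpoly_monic, hμ⟩
  have hs : g.charpoly.eval₂ (algebraMap Δ (integralClosure Δ F)) s = 0 := by
    apply Subtype.val_injective
    change (integralClosure Δ F).val.toRingHom _ = _
    rw [Polynomial.hom_eval₂]
    exact hμ
  have h1 := congrArg r hs
  rw [Polynomial.hom_eval₂, ← Polynomial.eval_map, ← Matrix.charpoly_map, hg, map_zero,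
    Matrix.charpoly_one] at h1
  refine ⟨s, rfl, ?_⟩
  simp only [Polynomial.eval_pow, Polynomial.eval_sub, Polynomial.eval_X, Polynomial.eval_one] at h1
  exact sub_eq_zero.mp (IsReduced.eq_zero _ ⟨_, h1⟩)

theorem exists_residueField_integralClosure {Δ F : Type*} [CommRing Δ] [Field F] [Algebra Δ F]
    [FaithfulSMul Δ F] {ρ : Ideal Δ} (hρ : ρ ≠ ⊤) :
    ∃ Q : Ideal (integralClosure Δ F), Q.IsMaximal ∧
      ρ ≤ Q.comap (algebraMap Δ (integralClosure Δ F)) := by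
  obtain ⟨m, hm, hρm⟩ := Ideal.exists_le_maximal ρ hρ
  obtain ⟨Q, hQ, hQm⟩ := Ideal.exists_ideal_over_maximal_of_isIntegral
    (S := integralClosure Δ F) m (by
      intro a ha
      have h0 : algebraMap Δ F a = 0 := congrArg Subtype.val ((RingHom.mem_ker).mp ha)
      rw [(map_eq_zero_iff _ (FaithfulSMul.algebraMap_injective Δ F)).mp h0]
      exact m.zero_mem)
  exact ⟨Q, hQ, hQm ▸ hρm⟩

/-- Matrices over `Δ` as operators on the column space over a `Δ`-algebra `F`. -/
def columnHom (n : ℕ) (Δ F : Type*) [CommRing Δ] [Field F] [Algebra Δ F] :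
    Matrix (Fin n) (Fin n) Δ →+* Module.End F (Fin n → F) :=
  (Matrix.toLinAlgEquiv' (R := F) (n := Fin n)).toRingEquiv.toRingHom.comp
    (algebraMap Δ F).mapMatrix

theorem columnHom_injective {n : ℕ} {Δ F : Type*} [CommRing Δ] [Field F] [Algebra Δ F]
    [FaithfulSMul Δ F] : Function.Injective (columnHom n Δ F) :=
  (Matrix.toLinAlgEquiv' (R := F) (n := Fin n)).injective.comp
    (Matrix.map_injective (FaithfulSMul.algebraMap_injective Δ F))

/-- The action of a group of invertible matrices over `Δ` on the column space over a
`Δ`-algebra `F`. -/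
def columnAction {n : ℕ} {Δ : Type*} [CommRing Δ] (F : Type*) [Field F] [Algebra Δ F]
    (K : Subgroup (GL (Fin n) Δ)) : K →* Module.End F (Fin n → F) :=
  (columnHom n Δ F).toMonoidHom.comp ((Units.coeHom _).comp K.subtype)

theorem hasNetSpectrum_columnAction {n : ℕ} {Δ F : Type*} [CommRing Δ] [Field F] [Algebra Δ F]
    [FaithfulSMul Δ F] (p : ℕ) [Fact p.Prime] [CharP F p] {ρ : Ideal Δ} (hρ : ρ ≠ ⊤)
    {K : Subgroup (GL (Fin n) Δ)}
    (hK : K ≤ (Matrix.GeneralLinearGroup.map (Ideal.Quotient.mk ρ)).ker) :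
    HasNetSpectrum (columnAction F K) := by
  obtain ⟨Q, hQ, hρQ⟩ := exists_residueField_integralClosure (F := F) hρ
  let : Field (integralClosure Δ F ⧸ Q) := Ideal.Quotient.field Q
  have : CharP (integralClosure Δ F) p :=
    (algebraMap (integralClosure Δ F) F).charP Subtype.val_injective p
  have hg (g : K) : ((g : GL (Fin n) Δ) : Matrix (Fin n) (Fin n) Δ).map
      ((Ideal.Quotient.mk Q).comp (algebraMap Δ (integralClosure Δ F))) = 1 := by
    have h1 : ((g : GL (Fin n) Δ) : Matrix (Fin n) (Fin n) Δ).map (Ideal.Quotient.mk ρ) = 1 :=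
      congrArg Units.val (MonoidHom.mem_ker.mp (hK g.2))
    have h2 := congrArg (fun M => Matrix.map M (Ideal.quotientMap Q _ hρQ)) h1
    simp only [Matrix.map_map] at h2
    rw [Matrix.map_one _ (map_zero _) (map_one _)] at h2
    rw [← h2]
    rfl
  intro g μ ν k hk hμ hν h
  obtain ⟨s, rfl, hs⟩ := exists_residue_eq_one_of_hasEigenvalue (μ := μ) _ (hg g) hμ
  obtain ⟨t, rfl, ht⟩ := exists_residue_eq_one_of_hasEigenvalue (μ := ν) _ (hg g) hν
  exact congrArg Subtype.val (eq_of_pow_eq_pow_of_map_eq_one p _ hs ht hk (Subtype.ext h))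

/-- Wehrfritz: if `Δ` is an integral domain of characteristic `p > n` and
`G ≤ GL(n, Δ)` is solvable-by-finite, then for any proper ideal `ρ` of `Δ` the commutator
subgroup of the congruence subgroup `G_ρ` is unipotent. -/
theorem stmt17 {n : ℕ} {Δ : Type*} [CommRing Δ] [IsDomain Δ]
    (p : ℕ) [Fact p.Prime] [CharP Δ p] (hpn : n < p)
    (G : Subgroup (GL (Fin n) Δ))
    (hsbf : ∃ N : Subgroup G, N.Normal ∧ N.FiniteIndex ∧ IsSolvable N)
    (ρ : Ideal Δ) (hρ : ρ ≠ ⊤) :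
    ∀ x ∈ ⁅G ⊓ (Matrix.GeneralLinearGroup.map (Ideal.Quotient.mk ρ)).ker,
        G ⊓ (Matrix.GeneralLinearGroup.map (Ideal.Quotient.mk ρ)).ker⁆,
      ((x : Matrix (Fin n) (Fin n) Δ) - 1) ^ n = 0 := by
  intro x hx
  set K := G ⊓ (Matrix.GeneralLinearGroup.map (Ideal.Quotient.mk ρ)).ker
  obtain ⟨N, hN, hfi, hsol⟩ := hsbf
  have : Group.IsSolvable N := hsol
  let i : K →* G := Subgroup.inclusion inf_le_left
  have hi : Function.Injective i := Subgroup.inclusion_injective _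
  let N' : Subgroup K := N.comap i
  have : N'.Normal := hN.comap i
  have : N'.FiniteIndex := 
    ⟨ne_zero_of_dvd_ne_zero hfi.index_ne_zero (by
      rw [Subgroup.index_comap]
      exact Subgroup.relIndex_dvd_index_of_normal N i.range)⟩
  have : Group.IsSolvable N' := Group.isSolvable_of_isSolvable_injective
    (f := i.subgroupComap N) fun a b hab => Subtype.ext (hi (congrArg Subtype.val hab))
  rw [← K.map_subtype_commutator] at hx
  obtain ⟨y, hy, rfl⟩ := hx
  let F := AlgebraicClosure (FractionRing Δ)
  have : FaithfulSMul Δ F := FaithfulSMul.trans Δ (FractionRing Δ) F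
  have : CharP F p := charP_of_injective_algebraMap (FaithfulSMul.algebraMap_injective Δ F) p
  have hnil : IsNilpotent (columnAction F K y - 1) :=
    isNilpotent_sub_one_of_mem_commutator p N' hy (by simpa using hpn)
      (hasNetSpectrum_columnAction p hρ inf_le_right)
  apply columnHom_injective (F := F)
  rw [map_pow, map_sub, map_one, map_zero]
  have h := (LinearMap.charpoly_nilpotent_tfae (columnAction F K y - 1)).out 0 1 |>.mp hnil
  have h' := LinearMap.aeval_self_charpoly (columnAction F K y - 1)
  rw [h, map_pow, Polynomial.aeval_X, Module.finrank_fin_fun] at h'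
  exact h'
end
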